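/- arXiv:2508.01657 — 3 statements merged into one kernel-verified Lean document; each statement's English description precedes it below -/
import Mathlib

section
/- Let d ∈ ℕ, 0 < α < d, and 1 ≤ q ≤ d/α. Then there exists a constant C = C(α, d, q) > 0, independent of θ, such that for every θ ∈ [0,1] and all nonnegative f ∈ L^{d/α,1}(ℝ^d) and g ∈ L^{q,1}(ℝ^d), one has ‖I_α^θ(f,g)‖_{L^{q,∞}(ℝ^d)} ≤ C ‖f‖_{L^{d/α,1}} ‖g‖_{L^{q,1}}. -/
open MeasureTheory Set
open scoped ENNReal NNReal

/-- The bilinear fractional integral operator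
`I_α^θ(f,g)(x) = ∫_{ℝ^d} f(x + (θ-1)y) g(x + θy) |y|^{α-d} dy`. -/
noncomputable def Ialpha (d : ℕ) (α θ : ℝ) (f g : EuclideanSpace ℝ (Fin d) → ℝ)
    (x : EuclideanSpace ℝ (Fin d)) : ℝ :=
  ∫ y : EuclideanSpace ℝ (Fin d), f (x + (θ - 1) • y) * g (x + θ • y) * ‖y‖ ^ (α - (d : ℝ))

/-- The weak Lebesgue `L^{r,∞}` quasinorm `‖h‖_{r,∞} = sup_{λ>0} λ |{x : |h(x)| > λ}|^{1/r}`. -/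
noncomputable def wnorm (r : ℝ) {d : ℕ} (h : EuclideanSpace ℝ (Fin d) → ℝ) : ℝ≥0∞ :=
  ⨆ (l : ℝ) (_ : 0 < l), ENNReal.ofReal l * volume {x | l < |h x|} ^ (1 / r)

/-- The decreasing rearrangement `h*` of a function `h`:
`h*(t) = inf {λ ≥ 0 : |{x : |h(x)| > λ}| ≤ t}`. -/
noncomputable def rearrangement {d : ℕ} (h : EuclideanSpace ℝ (Fin d) → ℝ) (t : ℝ) : ℝ≥0∞ :=
  sInf {l : ℝ≥0∞ | volume {x | l < ENNReal.ofReal |h x|} ≤ ENNReal.ofReal t}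

/-- The Lorentz `L^{p,1}` quasinorm `‖h‖_{p,1} = ∫_0^∞ t^{1/p} h*(t) dt/t`. -/
noncomputable def lorentzNorm (p : ℝ) {d : ℕ} (h : EuclideanSpace ℝ (Fin d) → ℝ) : ℝ≥0∞ :=
  ∫⁻ t in Set.Ioi (0 : ℝ), ENNReal.ofReal (t ^ (1 / p)) * rearrangement h t / ENNReal.ofReal t

/-- The Riesz kernel `|y|^{α-d}` as an extended nonnegative function. -/
noncomputable def rieszKernel (d : ℕ) (α : ℝ) (y : EuclideanSpace ℝ (Fin d)) : ℝ≥0∞ :=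
  ENNReal.ofReal (‖y‖ ^ (α - (d : ℝ)))

lemma measurable_rieszKernel (d : ℕ) (α : ℝ) : Measurable (rieszKernel d α) := by
  unfold rieszKernel
  fun_prop

lemma setLIntegral_ball_rieszKernel (d : ℕ) (hd : 0 < d) {α : ℝ} (hα : 0 < α) :
    ∃ C : ℝ, 0 ≤ C ∧ ∀ R : ℝ, 0 < R →
      ∫⁻ y in Metric.ball 0 R, rieszKernel d α y = ENNReal.ofReal (C * R ^ α) := by
  have : Nonempty (Fin d) := ⟨⟨0, hd⟩⟩
  refine ⟨∫ y in Metric.ball (0 : EuclideanSpace ℝ (Fin d)) 1, ‖y‖ ^ (α - (d : ℝ)),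
    integral_nonneg fun y => by positivity, fun R hR => ?_⟩
  have hint : IntegrableOn (fun y : EuclideanSpace ℝ (Fin d) => ‖y‖ ^ (α - (d : ℝ)))
      (Metric.ball 0 R) := by
    rw [integrableOn_fun_norm_addHaar volume (f := fun r : ℝ => r ^ (α - (d : ℝ)))]
    have h := (intervalIntegral.intervalIntegrable_rpow' (a := 0) (b := R)
      (r := α - 1) (by linarith))
    rw [intervalIntegrable_iff_integrableOn_Ioo_of_le hR.le] at h
    refine h.congr_fun (fun y hy => ?_) measurableSet_Ioo
    have hd' : ((d - 1 : ℕ) : ℝ) = d - 1 := by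
      rw [Nat.cast_sub hd]; simp
    simp only [finrank_euclideanSpace, Fintype.card_fin, smul_eq_mul]
    rw [← Real.rpow_natCast, ← Real.rpow_add hy.1, hd']
    congr 1; ring
  unfold rieszKernel
  rw [← ofReal_integral_eq_lintegral_ofReal hint (ae_of_all _ fun y => by positivity)]
  congr 1
  have h := Measure.setIntegral_comp_smul_of_pos (volume : Measure (EuclideanSpace ℝ (Fin d)))
    (fun y => ‖y‖ ^ (α - (d : ℝ))) (Metric.ball 0 1) hR
  rw [smul_unitBall_of_pos hR] at h
  simp only [finrank_euclideanSpace, Fintype.card_fin, smul_eq_mul, norm_smul,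
    Real.norm_eq_abs, abs_of_pos hR] at h
  simp_rw [Real.mul_rpow hR.le (norm_nonneg _), integral_const_mul] at h
  have hRd : (R ^ d) ≠ 0 := by positivity
  rw [eq_inv_mul_iff_mul_eq₀ hRd, ← mul_assoc, ← Real.rpow_natCast, ← Real.rpow_add hR] at h
  rw [← h, mul_comm]
  congr 2; ring

lemma setLIntegral_rieszKernel_le (d : ℕ) (hd : 0 < d) {α : ℝ} (hα : 0 < α) (hαd : α < d) :
    ∃ C : ℝ, 0 < C ∧ ∀ B : Set (EuclideanSpace ℝ (Fin d)),
      ∫⁻ y in B, rieszKernel d α y ≤ ENNReal.ofReal C * volume B ^ (α / d) := by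
  obtain ⟨C, hC, hball⟩ := setLIntegral_ball_rieszKernel d hd hα
  have hd0 : (0 : ℝ) < d := by exact_mod_cast hd
  refine ⟨C + 1, by positivity, fun B => ?_⟩
  rcases eq_or_ne (volume B) 0 with h0 | h0
  · rw [setLIntegral_measure_zero _ _ h0]; exact zero_le
  rcases eq_or_ne (volume B) ⊤ with h1 | h1
  · rw [h1, ENNReal.top_rpow_of_pos (by positivity), ENNReal.mul_top]
    · exact le_top
    · simp; linarith
  set m := (volume B).toReal with hm
  have hm0 : 0 < m := ENNReal.toReal_pos h0 h1
  have hmB : volume B = ENNReal.ofReal m := (ENNReal.ofReal_toReal h1).symm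
  set R := m ^ (1 / (d : ℝ)) with hR
  have hR0 : 0 < R := by positivity
  have hRα : R ^ α = m ^ (α / d) := by
    rw [hR, ← Real.rpow_mul hm0.le]; congr 1; ring
  have hRd : R ^ (α - d) * m = m ^ (α / d) := by
    rw [hR, ← Real.rpow_mul hm0.le, ← Real.rpow_add_one hm0.ne']; congr 1; field_simp; ring
  calc ∫⁻ y in B, rieszKernel d α y
      ≤ ∫⁻ y in Metric.ball 0 R ∪ (B \ Metric.ball 0 R), rieszKernel d α y :=
        lintegral_mono_set (by simp)
    _ ≤ (∫⁻ y in Metric.ball 0 R, rieszKernel d α y) +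
        ∫⁻ y in B \ Metric.ball 0 R, rieszKernel d α y := lintegral_union_le _ _ _
    _ ≤ ENNReal.ofReal (C * R ^ α) + ENNReal.ofReal (R ^ (α - d)) * volume B := by
        gcongr
        · exact (hball R hR0).le
        · calc _ ≤ ∫⁻ y in B \ Metric.ball 0 R, ENNReal.ofReal (R ^ (α - d)) := by
                refine setLIntegral_mono measurable_const ?_
                intro y hy
                have : R ≤ ‖y‖ := by simpa using hy.2
                exact ENNReal.ofReal_le_ofReal
                  (Real.rpow_le_rpow_of_nonpos hR0 this (by linarith))
            _ = ENNReal.ofReal (R ^ (α - d)) * volume (B \ Metric.ball 0 R) := by simp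
            _ ≤ _ := by gcongr; exact sdiff_subset
    _ = ENNReal.ofReal (C + 1) * volume B ^ (α / d) := by
        rw [hmB, ENNReal.ofReal_rpow_of_pos hm0, ← ENNReal.ofReal_mul (by positivity),
          ← ENNReal.ofReal_add (by positivity) (by positivity),
          ← ENNReal.ofReal_mul (by positivity), hRα, hRd]
        congr 1; ring

/-- The trilinear form of the fractional integral, evaluated on indicator functions, is controlled
by any two of its arguments provided the corresponding dilations are well separated. -/
lemma setLIntegral_pair_rieszKernel_le (d : ℕ) (hd : 0 < d) {α : ℝ} (hα : 0 < α) (hαd : α < d) :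
    ∃ C : ℝ, 0 < C ∧ ∀ S T : Set (EuclideanSpace ℝ (Fin d)), MeasurableSet S → MeasurableSet T →
      ∀ s t : ℝ, 1 / 2 ≤ |t - s| →
      ∫⁻ z in {z : EuclideanSpace ℝ (Fin d) × EuclideanSpace ℝ (Fin d) |
        z.1 + s • z.2 ∈ S ∧ z.1 + t • z.2 ∈ T}, rieszKernel d α z.2 ≤
        volume S * (ENNReal.ofReal C * volume T ^ (α / d)) := by
  obtain ⟨C, hC, hK⟩ := setLIntegral_rieszKernel_le d hd hα hαd
  refine ⟨C * (2 ^ d) ^ (α / d), by positivity, fun S T hS hT s t hst => ?_⟩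
  have hKm := measurable_rieszKernel d α
  have hmeas : MeasurableSet {z : EuclideanSpace ℝ (Fin d) × EuclideanSpace ℝ (Fin d) |
        z.1 + s • z.2 ∈ S ∧ z.1 + t • z.2 ∈ T} :=
    (hS.preimage (by fun_prop)).inter (hT.preimage (by fun_prop))
  have hts : t - s ≠ 0 := by
    intro h; rw [h] at hst; norm_num at hst
  have hin : ∀ x : EuclideanSpace ℝ (Fin d),
      ∫⁻ y in {y | x + (t - s) • y ∈ T}, rieszKernel d α y ≤
        ENNReal.ofReal (C * (2 ^ d) ^ (α / d)) * volume T ^ (α / d) := by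
    intro x
    refine (hK _).trans ?_
    have hvol : volume {y | x + (t - s) • y ∈ T} ≤ ENNReal.ofReal (2 ^ d) * volume T := by
      have : {y | x + (t - s) • y ∈ T} = ((t - s) • ·) ⁻¹' ((x + ·) ⁻¹' T) := rfl
      rw [this, Measure.addHaar_preimage_smul _ hts, measure_preimage_add]
      gcongr
      rw [finrank_euclideanSpace, Fintype.card_fin, abs_inv, abs_pow, ← inv_pow]
      gcongr
      rw [inv_le_comm₀ (by positivity) two_pos]
      linarith
    calc _ ≤ ENNReal.ofReal C * (ENNReal.ofReal (2 ^ d) * volume T) ^ (α / d) := by gcongr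
      _ = _ := by
        rw [ENNReal.mul_rpow_of_nonneg _ _ (by positivity),
          ENNReal.ofReal_rpow_of_pos (by positivity), ENNReal.ofReal_mul hC.le, mul_assoc]
  obtain ⟨A, hA⟩ : ∃ A : Set (EuclideanSpace ℝ (Fin d) × EuclideanSpace ℝ (Fin d)),
    A = {z | z.1 ∈ S ∧ z.1 + (t - s) • z.2 ∈ T} := ⟨_, rfl⟩
  have hmemA : ∀ x y, (x, y) ∈ A ↔ x ∈ S ∧ x + (t - s) • y ∈ T := by simp [hA]
  have hAm : MeasurableSet A := hA ▸ (hS.preimage (by fun_prop)).inter (hT.preimage (by fun_prop))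
  have hK2 : Measurable (fun z : EuclideanSpace ℝ (Fin d) × EuclideanSpace ℝ (Fin d) =>
    rieszKernel d α z.2) := hKm.comp measurable_snd
  calc _ = ∫⁻ z : EuclideanSpace ℝ (Fin d) × EuclideanSpace ℝ (Fin d),
          A.indicator (fun z => rieszKernel d α z.2) (z.1 + s • z.2, z.2) := by
        rw [← lintegral_indicator hmeas]
        refine lintegral_congr fun z => ?_
        have : (z.1 + s • z.2 + (t - s) • z.2) = z.1 + t • z.2 := by
          rw [sub_smul]; abel
        by_cases hz : z.1 + s • z.2 ∈ S ∧ z.1 + t • z.2 ∈ T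
        · rw [indicator_of_mem (by exact hz), indicator_of_mem ((hmemA _ _).2 (this ▸ hz))]
        · rw [indicator_of_notMem (by exact hz),
            indicator_of_notMem (fun h => hz (this ▸ (hmemA _ _).1 h))]
    _ = ∫⁻ y : EuclideanSpace ℝ (Fin d), ∫⁻ x : EuclideanSpace ℝ (Fin d),
          A.indicator (fun z => rieszKernel d α z.2) (x + s • y, y) := by
        rw [Measure.volume_eq_prod, lintegral_prod_symm']
        exact (hK2.indicator hAm).comp (by fun_prop)
    _ = ∫⁻ y : EuclideanSpace ℝ (Fin d), ∫⁻ x : EuclideanSpace ℝ (Fin d),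
          A.indicator (fun z => rieszKernel d α z.2) (x, y) := by
        refine lintegral_congr fun y => ?_
        exact lintegral_add_right_eq_self
          (fun x => A.indicator (fun z => rieszKernel d α z.2) (x, y)) (s • y)
    _ = ∫⁻ x : EuclideanSpace ℝ (Fin d), ∫⁻ y : EuclideanSpace ℝ (Fin d),
          A.indicator (fun z => rieszKernel d α z.2) (x, y) :=
        (lintegral_lintegral_swap
          (f := fun x y => A.indicator (fun z => rieszKernel d α z.2) (x, y))
          (hK2.indicator hAm).aemeasurable).symm
    _ ≤ ∫⁻ x : EuclideanSpace ℝ (Fin d), S.indicator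
          (fun _ => ENNReal.ofReal (C * (2 ^ d) ^ (α / d)) * volume T ^ (α / d)) x := by
        refine lintegral_mono fun x => ?_
        by_cases hx : x ∈ S
        · rw [indicator_of_mem hx]
          refine le_trans (le_of_eq ?_) (hin x)
          have hTx : MeasurableSet {y | x + (t - s) • y ∈ T} := hT.preimage (by fun_prop)
          rw [← lintegral_indicator hTx]
          refine lintegral_congr fun y => ?_
          by_cases hy : x + (t - s) • y ∈ T
          · rw [indicator_of_mem ((hmemA _ _).2 ⟨hx, hy⟩), indicator_of_mem (by exact hy)]
          · rw [indicator_of_notMem (fun h => hy ((hmemA _ _).1 h).2),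
              indicator_of_notMem (by exact hy)]
        · simp [indicator, hmemA, hx]
    _ = _ := by rw [lintegral_indicator_const hS, mul_comm]

lemma ENNReal.le_rpow_mul_rpow {x a b : ℝ≥0∞} {s t : ℝ} (hs : 0 ≤ s) (ht : 0 ≤ t)
    (hst : s + t = 1) (ha : x ≤ a) (hb : x ≤ b) : x ≤ a ^ s * b ^ t :=
  calc x = x ^ s * x ^ t := by rw [← ENNReal.rpow_add_of_nonneg _ _ hs ht, hst, ENNReal.rpow_one]
    _ ≤ _ := by gcongr

lemma ENNReal.mul_rpow_mul_mul_rpow {x y z : ℝ≥0∞} {s t : ℝ} (hs : 0 ≤ s) (ht : 0 ≤ t)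
    (hst : s + t = 1) : (x * y) ^ s * (z * y) ^ t = x ^ s * z ^ t * y := by
  rw [ENNReal.mul_rpow_of_nonneg _ _ hs, ENNReal.mul_rpow_of_nonneg _ _ ht,
    mul_mul_mul_comm, ← ENNReal.rpow_add_of_nonneg _ _ hs ht, hst, ENNReal.rpow_one]

lemma setLIntegral_triple_rieszKernel_le (d : ℕ) (hd : 0 < d) {α q : ℝ} (hα : 0 < α)
    (hαd : α < d) (hq : 1 ≤ q) (hqd : q ≤ d / α) :
    ∃ C : ℝ, 0 < C ∧ ∀ θ ∈ Icc (0 : ℝ) 1, ∀ F G H : Set (EuclideanSpace ℝ (Fin d)),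
      MeasurableSet F → MeasurableSet G → MeasurableSet H →
      ∫⁻ z in {z : EuclideanSpace ℝ (Fin d) × EuclideanSpace ℝ (Fin d) |
        z.1 ∈ H ∧ z.1 + (θ - 1) • z.2 ∈ F ∧ z.1 + θ • z.2 ∈ G}, rieszKernel d α z.2 ≤
        ENNReal.ofReal C * volume H ^ (1 - 1 / q) *
          (volume F ^ (1 / (d / α)) * volume G ^ (1 / q)) := by
  obtain ⟨C, hC, hpair⟩ := setLIntegral_pair_rieszKernel_le d hd hα hαd
  refine ⟨C, hC, fun θ hθ F G H hF hG hH => ?_⟩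
  have hd0 : (0 : ℝ) < d := by exact_mod_cast hd
  have hq0 : 0 < q := by linarith
  set X := ∫⁻ z in {z : EuclideanSpace ℝ (Fin d) × EuclideanSpace ℝ (Fin d) |
        z.1 ∈ H ∧ z.1 + (θ - 1) • z.2 ∈ F ∧ z.1 + θ • z.2 ∈ G}, rieszKernel d α z.2
  set a := α / d with ha
  have ha0 : 0 < a := by positivity
  have ha1 : a < 1 := by rw [ha, div_lt_one hd0]; exact hαd
  have hinv : 1 / (d / α) = a := by rw [one_div_div]
  have hqa : a ≤ 1 / q := by
    rw [← hinv]; exact one_div_le_one_div_of_le hq0 hqd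
  have hq1 : 1 / q ≤ 1 := by rw [div_le_one hq0]; exact hq
  rw [hinv]
  have hGF : X ≤ volume G * (ENNReal.ofReal C * volume F ^ a) := by
    refine le_trans (lintegral_mono_set ?_) (hpair G F hG hF θ (θ - 1) (by norm_num))
    exact fun z hz => ⟨hz.2.2, hz.2.1⟩
  set c := ENNReal.ofReal C
  rcases le_total θ (1 / 2) with h | h
  · have hHF : X ≤ volume H * (c * volume F ^ a) := by
      refine le_trans (lintegral_mono_set ?_) (hpair H F hH hF 0 (θ - 1) ?_)
      · exact fun z hz => ⟨by simpa using hz.1, hz.2.1⟩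
      · rw [sub_zero, abs_of_nonpos (by linarith)]; linarith
    refine (ENNReal.le_rpow_mul_rpow (sub_nonneg.2 hq1) (by positivity)
      (sub_add_cancel _ _) hHF hGF).trans_eq ?_
    rw [ENNReal.mul_rpow_mul_mul_rpow (sub_nonneg.2 hq1) (by positivity) (sub_add_cancel _ _)]
    ring
  · have hHG : X ≤ volume H * (c * volume G ^ a) := by
      refine le_trans (lintegral_mono_set ?_) (hpair H G hH hG 0 θ ?_)
      · exact fun z hz => ⟨by simpa using hz.1, hz.2.2⟩
      · rw [sub_zero, abs_of_nonneg hθ.1]; exact h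
    have hFG : X ≤ volume F * (c * volume G ^ a) := by
      refine le_trans (lintegral_mono_set ?_) (hpair F G hF hG (θ - 1) θ (by norm_num))
      exact fun z hz => ⟨hz.2.1, hz.2.2⟩
    have hFGH : X ≤ volume H ^ (1 - a) * volume G ^ a * (c * volume F ^ a) := by
      refine (ENNReal.le_rpow_mul_rpow (sub_nonneg.2 ha1.le) ha0.le
        (sub_add_cancel _ _) hHG hFG).trans_eq ?_
      rw [ENNReal.mul_rpow_mul_mul_rpow (sub_nonneg.2 ha1.le) ha0.le (sub_add_cancel _ _)]
      ring
    have ha1' : 0 < 1 - a := by linarith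
    set t := (1 - 1 / q) / (1 - a) with ht
    have ht0 : 0 ≤ t := div_nonneg (by linarith) ha1'.le
    have ht1 : 0 ≤ 1 - t := by
      rw [sub_nonneg, ht, div_le_one ha1']; linarith
    have hta : (1 - a) * t = 1 - 1 / q := by rw [ht]; field_simp
    refine (ENNReal.le_rpow_mul_rpow ht0 ht1 (by ring) hFGH hGF).trans_eq ?_
    rw [ENNReal.mul_rpow_mul_mul_rpow ht0 ht1 (by ring), ENNReal.mul_rpow_of_nonneg _ _ ht0,
      ← ENNReal.rpow_mul, ← ENNReal.rpow_mul, hta]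
    have hG' : volume G ^ (1 / q) = volume G ^ (a * t) * volume G ^ (1 - t) := by
      rw [← ENNReal.rpow_add_of_nonneg _ _ (by positivity) ht1]
      congr 1; linarith
    rw [hG']
    ring

lemma setLIntegral_Ioo_rpow {p b : ℝ} (hp : 0 < p) (hb : 0 ≤ b) :
    ∫⁻ t in Ioo 0 b, ENNReal.ofReal (t ^ (p - 1)) = ENNReal.ofReal (b ^ p / p) := by
  have hint := intervalIntegral.intervalIntegrable_rpow' (a := 0) (b := b) (r := p - 1)
    (by linarith)
  rw [intervalIntegrable_iff_integrableOn_Ioo_of_le hb] at hint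
  rw [← ofReal_integral_eq_lintegral_ofReal hint]
  · rw [← integral_Ioc_eq_integral_Ioo, ← intervalIntegral.integral_of_le hb,
      integral_rpow (Or.inl (by linarith)), sub_add_cancel, Real.zero_rpow hp.ne', sub_zero]
  · filter_upwards [ae_restrict_mem measurableSet_Ioo] with t ht
    exact Real.rpow_nonneg ht.1.le _

/-- A lower bound for `∫_0^m t^{p-1} dt` which also covers `m = ∞`. -/
lemma rpow_le_setLIntegral_rpow {p : ℝ} (hp : 0 < p) (hp1 : p ≤ 1) (m : ℝ≥0∞) :
    m ^ p ≤ ∫⁻ t in Ioi (0 : ℝ),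
      {t : ℝ | ENNReal.ofReal t < m}.indicator (fun t => ENNReal.ofReal (t ^ (p - 1))) t := by
  refine le_of_forall_lt fun c hc => ?_
  obtain ⟨b, hcb, hbm⟩ := ENNReal.lt_iff_exists_nnreal_btwn.1
    ((ENNReal.lt_rpow_inv_iff (inv_pos.2 hp)).1 ((inv_inv p).symm ▸ hc))
  have hcb' : c < (b : ℝ≥0∞) ^ p := by
    rw [← inv_inv p]; exact (ENNReal.lt_rpow_inv_iff (inv_pos.2 hp)).2 hcb
  calc c < (b : ℝ≥0∞) ^ p := hcb'
    _ ≤ ENNReal.ofReal ((b : ℝ) ^ p / p) := by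
        rw [← ENNReal.ofReal_coe_nnreal, ENNReal.ofReal_rpow_of_nonneg b.coe_nonneg hp.le]
        refine ENNReal.ofReal_le_ofReal ?_
        rw [le_div_iff₀ hp]
        exact mul_le_of_le_one_right (by positivity) hp1
    _ = ∫⁻ t in Ioo (0 : ℝ) b, ENNReal.ofReal (t ^ (p - 1)) :=
        (setLIntegral_Ioo_rpow hp b.2).symm
    _ ≤ ∫⁻ t in Ioo (0 : ℝ) b, {t : ℝ | ENNReal.ofReal t < m}.indicator
          (fun t => ENNReal.ofReal (t ^ (p - 1))) t := by
        refine setLIntegral_mono' measurableSet_Ioo fun t ht => ?_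
        have htm : t ∈ {t : ℝ | ENNReal.ofReal t < m} := by
          refine lt_of_le_of_lt ?_ hbm
          rw [← ENNReal.ofReal_coe_nnreal]
          exact ENNReal.ofReal_le_ofReal ht.2.le
        rw [indicator_of_mem htm]
    _ ≤ _ := lintegral_mono_set Ioo_subset_Ioi_self

lemma le_rearrangement {d : ℕ} {h : EuclideanSpace ℝ (Fin d) → ℝ} {s t : ℝ}
    (hst : ENNReal.ofReal t < volume {x | s < h x}) (hs : 0 ≤ s) :
    ENNReal.ofReal s ≤ rearrangement h t := by
  refine le_sInf fun l hl => ?_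
  by_contra! hls
  refine absurd (hst.trans_le ((measure_mono ?_).trans hl)) (lt_irrefl _)
  intro x hx
  have hx' : s < h x := hx
  exact hls.trans (ENNReal.ofReal_lt_ofReal_iff'.2 ⟨hx'.trans_le (le_abs_self _), by
    exact (hs.trans_lt hx').trans_le (le_abs_self _)⟩)

lemma lintegral_distribution_rpow_le_lorentzNorm {d : ℕ} {p : ℝ} (hp : 1 ≤ p)
    (h : EuclideanSpace ℝ (Fin d) → ℝ) :
    ∫⁻ s in Ioi (0 : ℝ), volume {x | s < h x} ^ (1 / p) ≤ lorentzNorm p h := by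
  have hp0 : 0 < p := by linarith
  set m : ℝ → ℝ≥0∞ := fun s => volume {x | s < h x} with hm
  have hanti : Antitone m := fun s s' hss => measure_mono fun x hx => lt_of_le_of_lt hss hx
  have hmm : Measurable m := hanti.measurable
  set A : Set (ℝ × ℝ) := {z | ENNReal.ofReal z.2 < m z.1} with hA
  have hAm : MeasurableSet A := measurableSet_lt (by fun_prop) (by fun_prop)
  calc ∫⁻ s in Ioi (0 : ℝ), m s ^ (1 / p)
      ≤ ∫⁻ s in Ioi (0 : ℝ), ∫⁻ t in Ioi (0 : ℝ),
        A.indicator (fun z => ENNReal.ofReal (z.2 ^ (1 / p - 1))) (s, t) := by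
        refine lintegral_mono fun s => ?_
        exact rpow_le_setLIntegral_rpow (by positivity) (by rw [div_le_one hp0]; exact hp) (m s)
    _ = ∫⁻ t in Ioi (0 : ℝ), ∫⁻ s in Ioi (0 : ℝ),
        A.indicator (fun z => ENNReal.ofReal (z.2 ^ (1 / p - 1))) (s, t) := by
        refine lintegral_lintegral_swap
          (f := fun s t => A.indicator (fun z => ENNReal.ofReal (z.2 ^ (1 / p - 1))) (s, t)) ?_
        refine (Measurable.indicator ?_ hAm).aemeasurable
        fun_prop
    _ ≤ lorentzNorm p h := by
        refine setLIntegral_mono' measurableSet_Ioi fun t ht => ?_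
        have ht : 0 < t := ht
        have hpow : ENNReal.ofReal (t ^ (1 / p)) * rearrangement h t / ENNReal.ofReal t =
            ENNReal.ofReal (t ^ (1 / p - 1)) * rearrangement h t := by
          rw [Real.rpow_sub_one ht.ne', ENNReal.ofReal_div_of_pos ht]
          simp only [div_eq_mul_inv]; ring
        rw [hpow]
        set r := rearrangement h t with hr
        calc _ ≤ ∫⁻ s in Ioi (0 : ℝ), {s : ℝ | ENNReal.ofReal s ≤ r}.indicator
              (fun _ => ENNReal.ofReal (t ^ (1 / p - 1))) s := by
              refine setLIntegral_mono' measurableSet_Ioi fun s hs => ?_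
              by_cases hsA : (s, t) ∈ A
              · have : s ∈ {s : ℝ | ENNReal.ofReal s ≤ r} := le_rearrangement hsA (le_of_lt hs)
                rw [indicator_of_mem hsA, indicator_of_mem this]
              · rw [indicator_of_notMem hsA]; exact zero_le
          _ = ENNReal.ofReal (t ^ (1 / p - 1)) *
              volume ({s : ℝ | ENNReal.ofReal s ≤ r} ∩ Ioi 0) := by
              rw [lintegral_indicator_const, Measure.restrict_apply]
              all_goals exact measurableSet_le (by fun_prop) (by fun_prop)
          _ ≤ _ := by
              gcongr
              rcases eq_or_ne r ⊤ with hr' | hr'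
              · rw [hr']; exact le_top
              · calc _ ≤ volume (Ioc 0 r.toReal) := by
                      refine measure_mono fun s hs => ⟨hs.2, ?_⟩
                      exact (ENNReal.ofReal_le_iff_le_toReal hr').1 hs.1
                  _ = r := by simp [ENNReal.ofReal_toReal hr']

lemma lintegral_mul_comp_eq_lintegral_measure {X : Type*} [MeasurableSpace X] (ν : Measure X)
    {u v : X → ℝ} (hu : Measurable u) (hv : Measurable v) (hu0 : 0 ≤ u) (hv0 : 0 ≤ v) :
    ∫⁻ z, ENNReal.ofReal (u z) * ENNReal.ofReal (v z) ∂ν =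
      ∫⁻ s in Ioi (0 : ℝ), ∫⁻ t in Ioi (0 : ℝ), ν {z | s < u z ∧ t < v z} := by
  have hvm : Measurable fun z => ENNReal.ofReal (v z) := hv.ennreal_ofReal
  have hum : Measurable fun z => ENNReal.ofReal (u z) := hu.ennreal_ofReal
  calc _ = ∫⁻ z, ENNReal.ofReal (u z) ∂(ν.withDensity fun z => ENNReal.ofReal (v z)) := by
        rw [lintegral_withDensity_eq_lintegral_mul _ hvm hum]
        simp only [Pi.mul_apply, mul_comm]
    _ = _ := by
        rw [lintegral_eq_lintegral_meas_lt _ (ae_of_all _ hu0) hu.aemeasurable]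
        refine lintegral_congr fun s => ?_
        have hs : MeasurableSet {z | s < u z} := measurableSet_lt measurable_const hu
        rw [withDensity_apply _ hs,
          lintegral_eq_lintegral_meas_lt _ (ae_of_all _ hv0) hv.aemeasurable]
        refine lintegral_congr fun t => ?_
        rw [Measure.restrict_apply (measurableSet_lt measurable_const hv), inter_comm]
        rfl

lemma ofReal_abs_Ialpha_le {d : ℕ} {α θ : ℝ} {f g : EuclideanSpace ℝ (Fin d) → ℝ} (hf : 0 ≤ f)
    (hg : 0 ≤ g) (x : EuclideanSpace ℝ (Fin d)) :
    ENNReal.ofReal |Ialpha d α θ f g x| ≤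
      ∫⁻ y, rieszKernel d α y *
        (ENNReal.ofReal (f (x + (θ - 1) • y)) * ENNReal.ofReal (g (x + θ • y))) := by
  refine (ofReal_norm (Ialpha d α θ f g x)).trans_le
    ((enorm_integral_le_lintegral_enorm _).trans_eq (lintegral_congr fun y => ?_))
  have h1 : 0 ≤ f (x + (θ - 1) • y) := hf _
  have h2 : 0 ≤ g (x + θ • y) := hg _
  rw [Real.enorm_of_nonneg (by positivity), ENNReal.ofReal_mul (by positivity),
    ENNReal.ofReal_mul h1, mul_comm]
  rfl

lemma setLIntegral_fractional_le (d : ℕ) (hd : 0 < d) {α q : ℝ} (hα : 0 < α)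
    (hαd : α < d) (hq : 1 ≤ q) (hqd : q ≤ d / α) :
    ∃ C : ℝ, 0 < C ∧ ∀ θ ∈ Icc (0 : ℝ) 1, ∀ f g : EuclideanSpace ℝ (Fin d) → ℝ,
      Measurable f → Measurable g → 0 ≤ f → 0 ≤ g →
      ∀ H : Set (EuclideanSpace ℝ (Fin d)), MeasurableSet H →
      ∫⁻ x in H, ∫⁻ y, rieszKernel d α y *
        (ENNReal.ofReal (f (x + (θ - 1) • y)) * ENNReal.ofReal (g (x + θ • y))) ≤
        ENNReal.ofReal C * volume H ^ (1 - 1 / q) *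
          (lorentzNorm (d / α) f * lorentzNorm q g) := by
  obtain ⟨C, hC, htriple⟩ := setLIntegral_triple_rieszKernel_le d hd hα hαd hq hqd
  refine ⟨C, hC, fun θ hθ f g hf hg hf0 hg0 H hH => ?_⟩
  have hKm := measurable_rieszKernel d α
  have hK2 : Measurable (fun z : EuclideanSpace ℝ (Fin d) × EuclideanSpace ℝ (Fin d) =>
    rieszKernel d α z.2) := hKm.comp measurable_snd
  set u : EuclideanSpace ℝ (Fin d) × EuclideanSpace ℝ (Fin d) → ℝ :=
    fun z => f (z.1 + (θ - 1) • z.2) with hu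
  set v : EuclideanSpace ℝ (Fin d) × EuclideanSpace ℝ (Fin d) → ℝ :=
    fun z => g (z.1 + θ • z.2) with hv
  have hum : Measurable u := hf.comp (by fun_prop)
  have hvm : Measurable v := hg.comp (by fun_prop)
  have huv : Measurable fun z => ENNReal.ofReal (u z) * ENNReal.ofReal (v z) := by fun_prop
  set ν := (((volume : Measure (EuclideanSpace ℝ (Fin d))).restrict H).prod
    (volume : Measure (EuclideanSpace ℝ (Fin d)))).withDensity fun z => rieszKernel d α z.2 with hν
  have hset : ∀ s t : ℝ, ν {z | s < u z ∧ t < v z} ≤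
      ENNReal.ofReal C * volume H ^ (1 - 1 / q) *
        (volume {x | s < f x} ^ (1 / (d / α)) * volume {x | t < g x} ^ (1 / q)) := by
    intro s t
    have hm : MeasurableSet {z | s < u z ∧ t < v z} :=
      (measurableSet_lt measurable_const hum).inter (measurableSet_lt measurable_const hvm)
    refine le_trans (le_of_eq ?_) (htriple θ hθ {x | s < f x} {x | t < g x} H
      (measurableSet_lt measurable_const hf) (measurableSet_lt measurable_const hg) hH)
    rw [hν, withDensity_apply _ hm, ← Measure.restrict_univ (μ := volume),
      Measure.restrict_restrict hH, Measure.prod_restrict, Measure.restrict_restrict hm, ← Measure.volume_eq_prod]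
    congr 2
    ext z
    simp only [mem_inter_iff, mem_prod, mem_univ, and_true]
    exact and_comm
  have hdist : ∀ (h : EuclideanSpace ℝ (Fin d) → ℝ) (r : ℝ),
      Measurable fun s : ℝ => volume {x | s < h x} ^ r := by
    intro h r
    have hanti : Antitone fun s : ℝ => volume {x | s < h x} :=
      fun s s' hss => measure_mono fun x hx => lt_of_le_of_lt hss hx
    exact hanti.measurable.pow_const r
  have hfm := hdist f (1 / (d / α))
  have hgm := hdist g (1 / q)
  calc _ = ∫⁻ z, ENNReal.ofReal (u z) * ENNReal.ofReal (v z) ∂ν := by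
        rw [hν, lintegral_withDensity_eq_lintegral_mul _ hK2 huv, lintegral_prod]
        · rfl
        · exact (hK2.mul huv).aemeasurable
    _ = ∫⁻ s in Ioi (0 : ℝ), ∫⁻ t in Ioi (0 : ℝ), ν {z | s < u z ∧ t < v z} :=
        lintegral_mul_comp_eq_lintegral_measure ν hum hvm (fun z => hf0 _) (fun z => hg0 _)
    _ ≤ ∫⁻ s in Ioi (0 : ℝ), ∫⁻ t in Ioi (0 : ℝ), ENNReal.ofReal C * volume H ^ (1 - 1 / q) *
        (volume {x | s < f x} ^ (1 / (d / α)) * volume {x | t < g x} ^ (1 / q)) := by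
        gcongr with s t
        exact hset s t
    _ = ENNReal.ofReal C * volume H ^ (1 - 1 / q) *
          ((∫⁻ s in Ioi (0 : ℝ), volume {x | s < f x} ^ (1 / (d / α))) *
            ∫⁻ t in Ioi (0 : ℝ), volume {x | t < g x} ^ (1 / q)) := by
        simp_rw [← mul_assoc]
        simp_rw [lintegral_const_mul _ hgm]
        rw [lintegral_mul_const _ (hfm.const_mul _), lintegral_const_mul _ hfm]
    _ ≤ _ := by
        gcongr
        · exact lintegral_distribution_rpow_le_lorentzNorm (hq.trans hqd) f
        · exact lintegral_distribution_rpow_le_lorentzNorm hq g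

lemma measurable_lintegral_fractional {d : ℕ} {α θ : ℝ} {f g : EuclideanSpace ℝ (Fin d) → ℝ}
    (hf : Measurable f) (hg : Measurable g) :
    Measurable fun x => ∫⁻ y, rieszKernel d α y *
        (ENNReal.ofReal (f (x + (θ - 1) • y)) * ENNReal.ofReal (g (x + θ • y))) := by
  refine Measurable.lintegral_prod_right' (f := fun z : EuclideanSpace ℝ (Fin d) ×
    EuclideanSpace ℝ (Fin d) => rieszKernel d α z.2 * (ENNReal.ofReal (f (z.1 + (θ - 1) • z.2)) *
      ENNReal.ofReal (g (z.1 + θ • z.2)))) ?_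
  have := measurable_rieszKernel d α
  fun_prop

/-- A duality criterion for weak type bounds. -/
lemma ofReal_mul_measure_rpow_le {X : Type*} [MeasurableSpace X] {μ : Measure X} [SigmaFinite μ]
    {J : X → ℝ≥0∞} (hJ : Measurable J) {q : ℝ} (hq : 0 < q) {D : ℝ≥0∞}
    (h : ∀ H : Set X, MeasurableSet H → ∫⁻ x in H, J x ∂μ ≤ D * μ H ^ (1 - 1 / q)) (l : ℝ≥0∞)
    (hl0 : l ≠ 0) (hl : l ≠ ⊤) : l * μ {x | l < J x} ^ (1 / q) ≤ D := by
  have hS : MeasurableSet {x | l < J x} := measurableSet_lt measurable_const hJ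
  rw [mul_comm, ← ENNReal.le_div_iff_mul_le (Or.inl hl0) (Or.inl hl), one_div,
    ENNReal.rpow_inv_le_iff hq]
  refine le_of_forall_lt fun c hc => ?_
  obtain ⟨H, hH, hHS, hcH, hHtop⟩ := Measure.exists_subset_measure_lt_top hS hc
  refine hcH.trans_le ?_
  rw [← ENNReal.rpow_inv_le_iff hq, ENNReal.le_div_iff_mul_le (Or.inl hl0) (Or.inl hl)]
  have hH0 : μ H ≠ 0 := (zero_le.trans_lt hcH).ne'
  have h1 : l * μ H ≤ D * μ H ^ (1 - 1 / q) := by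
    refine le_trans ?_ (h H hH)
    rw [← setLIntegral_const]
    exact setLIntegral_mono hJ fun x hx => (hHS hx).le
  have hpos : μ H ^ (1 - 1 / q) ≠ 0 := (ENNReal.rpow_pos hH0.bot_lt hHtop.ne).ne'
  have hfin : μ H ^ (1 - 1 / q) ≠ ⊤ := ENNReal.rpow_ne_top_of_ne_zero hH0 hHtop.ne
  rw [← ENNReal.mul_le_mul_iff_left hpos hfin]
  refine le_trans (le_of_eq ?_) h1
  rw [mul_right_comm, ← ENNReal.rpow_add _ _ hH0 hHtop.ne, one_div, add_sub_cancel,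
    ENNReal.rpow_one, mul_comm]

/-- Fully uniform weak-type bound on the left edge for Lorentz data:
`L^{d/α,1} × L^{q,1} → L^{q,∞}` for `1 ≤ q ≤ d/α`, uniformly in `θ ∈ [0,1]`. -/
theorem lorentz_bound_inner_wall (d : ℕ) (hd : 0 < d) (α q : ℝ)
    (hα : 0 < α) (hαd : α < d) (hq : 1 ≤ q) (hqd : q ≤ d / α) :
    ∃ C : ℝ, 0 < C ∧ ∀ θ : ℝ, θ ∈ Set.Icc (0 : ℝ) 1 →
      ∀ f g : EuclideanSpace ℝ (Fin d) → ℝ, Measurable f → Measurable g →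
        0 ≤ f → 0 ≤ g → lorentzNorm (d / α) f < ⊤ → lorentzNorm q g < ⊤ →
        wnorm q (Ialpha d α θ f g) ≤
          ENNReal.ofReal C * lorentzNorm (d / α) f * lorentzNorm q g := by
  obtain ⟨C, hC, hmain⟩ := setLIntegral_fractional_le d hd hα hαd hq hqd
  refine ⟨C, hC, fun θ hθ f g hf hg hf0 hg0 _ _ => iSup₂_le fun l hl => ?_⟩
  have hweak := ofReal_mul_measure_rpow_le (μ := volume)
    (measurable_lintegral_fractional (α := α) (θ := θ) hf hg) (q := q) (by linarith)
    (D := ENNReal.ofReal C * lorentzNorm (d / α) f * lorentzNorm q g)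
    (fun H hH => (hmain θ hθ f g hf hg hf0 hg0 H hH).trans_eq (by ring))
    (ENNReal.ofReal l) (ENNReal.ofReal_pos.2 hl).ne' ENNReal.ofReal_ne_top
  refine le_trans ?_ hweak
  gcongr with x
  intro hx
  exact ((ENNReal.ofReal_lt_ofReal_iff').2 ⟨hx, hl.trans hx⟩).trans_le
    (ofReal_abs_Ialpha_le hf0 hg0 x)
end

section
/- Let d ∈ ℕ, θ ∈ [0,1], j ∈ ℤ, 1 ≤ p ≤ ∞, and let E ⊆ ℝ^d be measurable with |E| < ∞. Then there exists a constant C = C(d, p) > 0, independent of θ and j, such that for all nonnegative measurable functions f, g on ℝ^d, ‖I_j^θ(f,g) χ_E‖_{L^{1/2}(ℝ^d)} ≤ C (2^{dj}|E|)^{1−1/p} ‖f‖_{L^p} ‖g‖_{L^1} · min{2^{dj}, |E|}^{1/p}. -/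
open MeasureTheory Set
open scoped ENNReal NNReal

/-- The truncated bilinear averaging operator
`I_j^θ(f,g)(x) = ∫_{|y| ≤ 2^j} f(x + (θ-1)y) g(x + θy) dy`. -/
noncomputable def Ij (d : ℕ) (θ : ℝ) (j : ℤ) (f g : EuclideanSpace ℝ (Fin d) → ℝ)
    (x : EuclideanSpace ℝ (Fin d)) : ℝ :=
  ∫ y in {y : EuclideanSpace ℝ (Fin d) | ‖y‖ ≤ 2 ^ j}, f (x + (θ - 1) • y) * g (x + θ • y)

/-- The integral of `F` over the ball of radius `r` centred at `x`. -/
noncomputable def ballIntegral {V : Type*} [NormedAddCommGroup V] [MeasureSpace V]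
    (F : V → ℝ≥0∞) (r : ℝ) (x : V) : ℝ≥0∞ :=
  ∫⁻ y in Metric.closedBall (0 : V) r, F (x - y)

/-- The `ℝ≥0∞`-valued bilinear average over the ball of radius `r`. -/
noncomputable def bilinearAverage {V : Type*} [NormedAddCommGroup V] [NormedSpace ℝ V]
    [MeasureSpace V] (θ r : ℝ) (F G : V → ℝ≥0∞) (x : V) : ℝ≥0∞ :=
  ∫⁻ y in Metric.closedBall (0 : V) r, F (x + (θ - 1) • y) * G (x + θ • y)

section Average

variable {V : Type*} [NormedAddCommGroup V] [InnerProductSpace ℝ V] [FiniteDimensional ℝ V]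
  [MeasurableSpace V] [BorelSpace V]

lemma measurable_ballIntegral {F : V → ℝ≥0∞} (hF : Measurable F) (r : ℝ) :
    Measurable (ballIntegral F r) := by
  unfold ballIntegral
  exact Measurable.lintegral_prod_right' (f := fun z : V × V => F (z.1 - z.2)) (by fun_prop)

lemma measurable_bilinearAverage {F G : V → ℝ≥0∞} (hF : Measurable F) (hG : Measurable G)
    (θ r : ℝ) : Measurable (bilinearAverage θ r F G) := by
  unfold bilinearAverage
  exact Measurable.lintegral_prod_right'
    (f := fun z : V × V => F (z.1 + (θ - 1) • z.2) * G (z.1 + θ • z.2)) (by fun_prop)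

/-- Enlarging a ball so that it contains another one increases the integral. -/
lemma ballIntegral_mono (F : V → ℝ≥0∞) {r s : ℝ} {v x : V} (h : ‖x - v‖ + r ≤ s) :
    ballIntegral F r v ≤ ballIntegral F s x := by
  unfold ballIntegral
  rw [← lintegral_indicator Metric.isClosed_closedBall.measurableSet,
    ← lintegral_indicator Metric.isClosed_closedBall.measurableSet,
    ← lintegral_add_right_eq_self ((Metric.closedBall (0 : V) s).indicator _) (x - v)]
  refine lintegral_mono fun y => ?_
  by_cases hy : y ∈ Metric.closedBall (0 : V) r
  · have hy' : y + (x - v) ∈ Metric.closedBall (0 : V) s := by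
      rw [mem_closedBall_zero_iff] at hy ⊢
      linarith [norm_add_le y (x - v)]
    rw [indicator_of_mem hy, indicator_of_mem hy']
    exact le_of_eq (congrArg F (by abel))
  · rw [indicator_of_notMem hy]
    exact zero_le

/-- Weighted integral of the bilinear average, after the unimodular change of variables
`v = x + θ y`. -/
lemma lintegral_bilinearAverage_mul {F G h : V → ℝ≥0∞} (hF : Measurable F) (hG : Measurable G)
    (hh : Measurable h) (θ r : ℝ) :
    ∫⁻ x, bilinearAverage θ r F G x * h x =
      ∫⁻ v, G v * ∫⁻ y in Metric.closedBall (0 : V) r, F (v - y) * h (v - θ • y) := by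
  calc ∫⁻ x, bilinearAverage θ r F G x * h x
      = ∫⁻ x, ∫⁻ y in Metric.closedBall (0 : V) r,
          F (x + (θ - 1) • y) * G (x + θ • y) * h x := by
        refine lintegral_congr fun x => ?_
        unfold bilinearAverage
        rw [lintegral_mul_const _ (by fun_prop)]
    _ = ∫⁻ y in Metric.closedBall (0 : V) r, ∫⁻ x,
          F (x + (θ - 1) • y) * G (x + θ • y) * h x :=
        lintegral_lintegral_swap (by unfold Function.uncurry; fun_prop)
    _ = ∫⁻ y in Metric.closedBall (0 : V) r, ∫⁻ v, G v * (F (v - y) * h (v - θ • y)) := by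
        refine lintegral_congr fun y => ?_
        rw [← lintegral_sub_right_eq_self _ (θ • y)]
        refine lintegral_congr fun v => ?_
        have h1 : v - θ • y + (θ - 1) • y = v - y := by module
        have h2 : v - θ • y + θ • y = v := by module
        rw [h1, h2]
        ring
    _ = ∫⁻ v, ∫⁻ y in Metric.closedBall (0 : V) r, G v * (F (v - y) * h (v - θ • y)) :=
        lintegral_lintegral_swap (by unfold Function.uncurry; fun_prop)
    _ = _ := by
        refine lintegral_congr fun v => ?_
        rw [lintegral_const_mul _ (by fun_prop)]

/-- Weighting the bilinear average by the inverse of the local mass of `F` leaves at most the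
mass of `G`. -/
lemma lintegral_bilinearAverage_mul_inv_le {F G : V → ℝ≥0∞} (hF : Measurable F)
    (hG : Measurable G) {θ r : ℝ} (hθ : θ ∈ Icc (0 : ℝ) 1) :
    ∫⁻ x, bilinearAverage θ r F G x * (ballIntegral F (2 * r) x)⁻¹ ≤ ∫⁻ v, G v := by
  refine (lintegral_bilinearAverage_mul hF hG
    (measurable_ballIntegral hF (2 * r)).inv θ r).trans_le ?_
  refine lintegral_mono fun v => ?_
  refine mul_le_of_le_one_right' ?_
  calc ∫⁻ y in Metric.closedBall (0 : V) r, F (v - y) * (ballIntegral F (2 * r) (v - θ • y))⁻¹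
      ≤ ∫⁻ y in Metric.closedBall (0 : V) r, F (v - y) * (ballIntegral F r v)⁻¹ := by
        refine setLIntegral_mono (by fun_prop) fun y hy => ?_
        gcongr
        refine ballIntegral_mono F ?_
        rw [mem_closedBall_zero_iff] at hy
        rw [sub_sub_cancel_left, norm_neg, norm_smul, Real.norm_of_nonneg hθ.1]
        nlinarith [mul_le_mul hθ.2 hy (norm_nonneg y) zero_le_one]
    _ = ballIntegral F r v * (ballIntegral F r v)⁻¹ := by
        rw [lintegral_mul_const _ (by fun_prop)]; rfl
    _ ≤ 1 := ENNReal.mul_inv_le_one _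

lemma bilinearAverage_ae_eq_zero_left {F G : V → ℝ≥0∞} (hF : Measurable F) (hG : Measurable G)
    (h : F =ᵐ[volume] 0) (θ r : ℝ) : bilinearAverage θ r F G =ᵐ[volume] 0 := by
  rw [← lintegral_eq_zero_iff (measurable_bilinearAverage hF hG θ r)]
  have key := lintegral_bilinearAverage_mul hF hG (measurable_const (a := (1 : ℝ≥0∞))) θ r
  simp only [mul_one] at key
  rw [key]
  refine (lintegral_congr fun v => ?_).trans lintegral_zero
  have h0 : ∫⁻ y, F (v - y) = 0 := by
    rw [lintegral_sub_left_eq_self F v, lintegral_eq_zero_iff hF]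
    exact h
  rw [le_antisymm ((setLIntegral_le_lintegral _ _).trans h0.le) zero_le, mul_zero]

lemma bilinearAverage_ae_eq_zero_right {F G : V → ℝ≥0∞} (hF : Measurable F) (hG : Measurable G)
    (h : G =ᵐ[volume] 0) (θ r : ℝ) : bilinearAverage θ r F G =ᵐ[volume] 0 := by
  rw [← lintegral_eq_zero_iff (measurable_bilinearAverage hF hG θ r)]
  have key := lintegral_bilinearAverage_mul hF hG (measurable_const (a := (1 : ℝ≥0∞))) θ r
  simp only [mul_one] at key
  rw [key]
  refine (lintegral_congr_ae ?_).trans lintegral_zero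
  filter_upwards [h] with v hv
  rw [hv, Pi.zero_apply, zero_mul]

/-- Hölder's inequality against the characteristic function of a set. -/
lemma setLIntegral_enorm_le {f : V → ℝ} (hf : Measurable f) {p : ℝ≥0∞} (hp : 1 ≤ p) (S : Set V) :
    ∫⁻ x in S, ‖f x‖ₑ ≤ eLpNorm f p volume * volume S ^ (1 - (1 / p).toReal) := by
  have h := eLpNorm_le_eLpNorm_mul_rpow_measure_univ (μ := volume.restrict S) hp
    hf.aestronglyMeasurable
  rw [eLpNorm_one_eq_lintegral_enorm, Measure.restrict_apply_univ] at h
  have he : (1 / p).toReal = 1 / p.toReal := by simp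
  rw [he]
  simp only [ENNReal.toReal_one, div_one] at h
  exact h.trans (by gcongr; exact Measure.restrict_le_self)

lemma ballIntegral_le {f : V → ℝ} (hf : Measurable f) {p : ℝ≥0∞} (hp : 1 ≤ p) (r : ℝ) (x : V) :
    ballIntegral (fun y => ‖f y‖ₑ) r x ≤
      eLpNorm f p volume * volume (Metric.closedBall (0 : V) r) ^ (1 - (1 / p).toReal) := by
  have h := setLIntegral_enorm_le (f := fun y => f (x - y)) (by fun_prop) hp
    (Metric.closedBall (0 : V) r)
  rwa [show (fun y => f (x - y)) = f ∘ fun y => x - y from rfl,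
    eLpNorm_comp_measurePreserving hf.aestronglyMeasurable
      (Measure.measurePreserving_sub_left volume x)] at h

lemma setLIntegral_ballIntegral_le_measure_mul {f : V → ℝ} (hf : Measurable f) {p : ℝ≥0∞}
    (hp : 1 ≤ p) (r : ℝ) (E : Set V) :
    ∫⁻ x in E, ballIntegral (fun y => ‖f y‖ₑ) r x ≤
      eLpNorm f p volume *
        (volume (Metric.closedBall (0 : V) r) ^ (1 - (1 / p).toReal) * volume E) := by
  refine (lintegral_mono fun x => ballIntegral_le hf hp r x).trans ?_
  rw [setLIntegral_const, mul_assoc]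

lemma setLIntegral_ballIntegral_le_measure_closedBall_mul {f : V → ℝ} (hf : Measurable f)
    {p : ℝ≥0∞} (hp : 1 ≤ p) (r : ℝ) (E : Set V) :
    ∫⁻ x in E, ballIntegral (fun y => ‖f y‖ₑ) r x ≤
      eLpNorm f p volume *
        (volume E ^ (1 - (1 / p).toReal) * volume (Metric.closedBall (0 : V) r)) := by
  unfold ballIntegral
  rw [lintegral_lintegral_swap (by unfold Function.uncurry; fun_prop), ← mul_assoc,
    ← setLIntegral_const]
  refine lintegral_mono fun y => ?_
  have h := setLIntegral_enorm_le (f := fun x => f (x - y)) (by fun_prop) hp E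
  rwa [show (fun x => f (x - y)) = f ∘ fun x => x - y from rfl,
    eLpNorm_comp_measurePreserving hf.aestronglyMeasurable
      (measurePreserving_sub_right volume y)] at h

end Average

/-- The Cauchy–Schwarz inequality for the `L^{1/2}` quasinorm of a product. -/
lemma lintegral_rpow_half_sq_le {α : Type*} [MeasurableSpace α] {μ : Measure α}
    {J H w : α → ℝ≥0∞} (hH : Measurable H) (hw : Measurable w) (hJ : ∀ᵐ x ∂μ, J x ≤ H x * w x) :
    (∫⁻ x, J x ^ (1 / 2 : ℝ) ∂μ) ^ (2 : ℝ) ≤ (∫⁻ x, H x ∂μ) * ∫⁻ x, w x ∂μ := by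
  have hpow : ∀ a : ℝ≥0∞, (a ^ (1 / 2 : ℝ)) ^ (2 : ℝ) = a := fun a => by
    rw [← ENNReal.rpow_mul]; norm_num
  have h := ENNReal.lintegral_mul_le_Lp_mul_Lq μ Real.HolderConjugate.two_two
    (hH.pow_const (1 / 2 : ℝ)).aemeasurable (hw.pow_const (1 / 2 : ℝ)).aemeasurable
  simp only [hpow, Pi.mul_apply] at h
  calc (∫⁻ x, J x ^ (1 / 2 : ℝ) ∂μ) ^ (2 : ℝ)
      ≤ (∫⁻ x, H x ^ (1 / 2 : ℝ) * w x ^ (1 / 2 : ℝ) ∂μ) ^ (2 : ℝ) := by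
        refine ENNReal.rpow_le_rpow (lintegral_mono_ae ?_) (by norm_num)
        filter_upwards [hJ] with x hx
        rw [← ENNReal.mul_rpow_of_nonneg _ _ (by norm_num)]
        exact ENNReal.rpow_le_rpow hx (by norm_num)
    _ ≤ ((∫⁻ x, H x ∂μ) ^ (1 / 2 : ℝ) * (∫⁻ x, w x ∂μ) ^ (1 / 2 : ℝ)) ^ (2 : ℝ) :=
        ENNReal.rpow_le_rpow h (by norm_num)
    _ = _ := by rw [ENNReal.mul_rpow_of_nonneg _ _ (by norm_num), hpow, hpow]

lemma enorm_Ij_le (d : ℕ) (θ : ℝ) (j : ℤ) (f g : EuclideanSpace ℝ (Fin d) → ℝ)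
    (x : EuclideanSpace ℝ (Fin d)) :
    ‖Ij d θ j f g x‖ₑ ≤
      bilinearAverage θ ((2 : ℝ) ^ j) (fun y => ‖f y‖ₑ) (fun y => ‖g y‖ₑ) x := by
  have hset : {y : EuclideanSpace ℝ (Fin d) | ‖y‖ ≤ 2 ^ j} = Metric.closedBall 0 ((2 : ℝ) ^ j) := by
    ext y; simp
  unfold Ij bilinearAverage
  rw [hset]
  refine (enorm_integral_le_lintegral_enorm _).trans (le_of_eq ?_)
  simp only [enorm_mul]

/-- The `L^{1/2}` quasinorm of `I_j^θ(f,g)` on `E` is controlled by the local mass of `f` on `E`. -/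
lemma eLpNorm_Ij_le {d : ℕ} {θ : ℝ} (hθ : θ ∈ Icc (0 : ℝ) 1) (j : ℤ)
    (E : Set (EuclideanSpace ℝ (Fin d))) {f g : EuclideanSpace ℝ (Fin d) → ℝ}
    (hf : Measurable f) (hg : Measurable g) (hg1 : eLpNorm g 1 volume ≠ ⊤)
    (hw : ∀ x, ballIntegral (fun y => ‖f y‖ₑ) (2 * (2 : ℝ) ^ j) x ≠ ⊤) :
    eLpNorm (Ij d θ j f g) (ENNReal.ofReal (1 / 2)) (volume.restrict E) ≤
      eLpNorm g 1 volume *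
        ∫⁻ x in E, ballIntegral (fun y => ‖f y‖ₑ) (2 * (2 : ℝ) ^ j) x := by
  have hF : Measurable fun y => ‖f y‖ₑ := hf.enorm
  have hG : Measurable fun y => ‖g y‖ₑ := hg.enorm
  have hwm := measurable_ballIntegral hF (2 * (2 : ℝ) ^ j)
  have hJm := measurable_bilinearAverage hF hG θ ((2 : ℝ) ^ j)
  have hint := lintegral_bilinearAverage_mul_inv_le (r := (2 : ℝ) ^ j) hF hG hθ
  rw [eLpNorm_one_eq_lintegral_enorm] at hg1 ⊢
  have hfin := ae_lt_top (hJm.mul hwm.inv) (hint.trans_lt hg1.lt_top).ne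
  rw [eLpNorm_eq_lintegral_rpow_enorm_toReal (by simp) (by simp),
    ENNReal.toReal_ofReal (by norm_num), show (1 / (1 / 2) : ℝ) = 2 by norm_num]
  refine (lintegral_rpow_half_sq_le (hJm.mul hwm.inv) hwm ?_).trans
    (mul_le_mul_left ((setLIntegral_le_lintegral _ _).trans hint) _)
  filter_upwards [ae_restrict_of_ae hfin] with x hx
  refine (enorm_Ij_le d θ j f g x).trans ?_
  simp only [Pi.mul_apply, Pi.inv_apply] at hx ⊢
  by_cases h0 : ballIntegral (fun y => ‖f y‖ₑ) (2 * (2 : ℝ) ^ j) x = 0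
  · rw [h0, ENNReal.inv_zero] at hx
    rcases eq_or_ne (bilinearAverage θ ((2 : ℝ) ^ j) (fun y => ‖f y‖ₑ) (fun y => ‖g y‖ₑ) x) 0
      with h | h
    · rw [h]; exact zero_le
    · rw [ENNReal.mul_top h] at hx
      exact absurd hx (lt_irrefl _)
  · rw [mul_assoc, ENNReal.inv_mul_cancel h0 (hw x), mul_one]

lemma volume_closedBall_two_mul_zpow (d : ℕ) (j : ℤ) :
    volume (Metric.closedBall (0 : EuclideanSpace ℝ (Fin d)) (2 * (2 : ℝ) ^ j)) =
      ENNReal.ofReal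
        (2 ^ d * (volume (Metric.ball (0 : EuclideanSpace ℝ (Fin d)) 1)).toReal *
          (2 : ℝ) ^ ((d : ℤ) * j)) := by
  rw [Measure.addHaar_closedBall _ _ (by positivity), finrank_euclideanSpace_fin,
    mul_right_comm, ENNReal.ofReal_mul (by positivity),
    ENNReal.ofReal_toReal Metric.isBounded_ball.measure_lt_top.ne]
  congr 2
  rw [mul_pow, ← zpow_natCast ((2 : ℝ) ^ j), ← zpow_mul, mul_comm j]

lemma le_mul_rpow_mul_min_rpow {K N e b : ℝ} (hK : 0 ≤ K) (hN : 0 < N) (he : 0 < e)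
    (hb : 0 ≤ b) (hb1 : b ≤ 1) :
    min ((K * N) ^ (1 - b) * e) (e ^ (1 - b) * (K * N)) ≤
      (1 + K) * (N * e) ^ (1 - b) * min N e ^ b := by
  have hsplit : ∀ t : ℝ, 0 < t → t = t ^ (1 - b) * t ^ b := fun t ht => by
    rw [← Real.rpow_add ht, sub_add_cancel, Real.rpow_one]
  have hKb : K ^ (1 - b) ≤ 1 + K := by
    calc K ^ (1 - b) ≤ (1 + K) ^ (1 - b) :=
          Real.rpow_le_rpow hK (by linarith) (by linarith)
      _ ≤ (1 + K) ^ (1 : ℝ) := Real.rpow_le_rpow_of_exponent_le (by linarith) (by linarith)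
      _ = 1 + K := Real.rpow_one _
  rw [Real.mul_rpow hN.le he.le]
  rcases le_total N e with h | h
  · rw [min_eq_left h]
    refine (min_le_right _ _).trans ?_
    calc e ^ (1 - b) * (K * N) = K * (N ^ (1 - b) * e ^ (1 - b) * N ^ b) := by
          conv_lhs => rw [hsplit N hN]
          ring
      _ ≤ (1 + K) * (N ^ (1 - b) * e ^ (1 - b) * N ^ b) := by gcongr; linarith
      _ = _ := by ring
  · rw [min_eq_right h]
    refine (min_le_left _ _).trans ?_
    calc (K * N) ^ (1 - b) * e = K ^ (1 - b) * (N ^ (1 - b) * e ^ (1 - b) * e ^ b) := by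
          conv_lhs => rw [hsplit e he]
          rw [Real.mul_rpow hK hN.le]
          ring
      _ ≤ (1 + K) * (N ^ (1 - b) * e ^ (1 - b) * e ^ b) := by gcongr
      _ = _ := by ring

/-- `‖I_j^θ(f,g) χ_E‖_{L^{1/2}} ≤ C (2^{dj}|E|)^{1-1/p} ‖f‖_{L^p} ‖g‖_{L^1}
min{2^{dj}, |E|}^{1/p}` for `1 ≤ p ≤ ∞`, with `C = C(d,p)` independent of `θ` and `j`. -/
theorem Ij_localized_bound (d : ℕ) (hd : 0 < d) (p : ℝ≥0∞) (hp : 1 ≤ p) :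
    ∃ C : ℝ, 0 < C ∧ ∀ θ : ℝ, θ ∈ Set.Icc (0 : ℝ) 1 → ∀ j : ℤ,
      ∀ E : Set (EuclideanSpace ℝ (Fin d)), MeasurableSet E → volume E < ⊤ →
      ∀ f g : EuclideanSpace ℝ (Fin d) → ℝ, Measurable f → Measurable g →
        0 ≤ f → 0 ≤ g →
        eLpNorm (E.indicator (Ij d θ j f g)) (ENNReal.ofReal (1 / 2)) volume ≤
          ENNReal.ofReal (C * ((2 : ℝ) ^ ((d : ℤ) * j) * (volume E).toReal) ^ (1 - (1 / p).toReal) *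
              min ((2 : ℝ) ^ ((d : ℤ) * j)) (volume E).toReal ^ (1 / p).toReal) *
            eLpNorm f p volume * eLpNorm g 1 volume := by
  set K : ℝ := 2 ^ d * (volume (Metric.ball (0 : EuclideanSpace ℝ (Fin d)) 1)).toReal with hKdef
  have hK : 0 ≤ K := by positivity
  refine ⟨1 + K, by linarith, fun θ hθ j E hE hEfin f g hf hg _ _ => ?_⟩
  have hN : 0 < (2 : ℝ) ^ ((d : ℤ) * j) := by positivity
  rw [eLpNorm_indicator_eq_eLpNorm_restrict hE]
  rcases eq_or_ne (volume E) 0 with hE0 | hE0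
  · rw [Measure.restrict_eq_zero.2 hE0, eLpNorm_measure_zero]
    exact zero_le
  have he : 0 < (volume E).toReal := ENNReal.toReal_pos hE0 hEfin.ne
  have hvanish : bilinearAverage θ ((2 : ℝ) ^ j) (fun y => ‖f y‖ₑ) (fun y => ‖g y‖ₑ)
      =ᵐ[volume] 0 →
      eLpNorm (Ij d θ j f g) (ENNReal.ofReal (1 / 2)) (volume.restrict E) = 0 := fun h => by
    have hI : Ij d θ j f g =ᵐ[volume.restrict E] 0 := by
      filter_upwards [ae_restrict_of_ae h] with x hx
      have hle := enorm_Ij_le d θ j f g x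
      rw [hx] at hle
      exact enorm_eq_zero.1 (le_antisymm hle zero_le)
    rw [eLpNorm_congr_ae hI, eLpNorm_zero]
  rcases eq_or_ne (eLpNorm f p volume) 0 with hf0 | hf0
  · rw [hvanish (bilinearAverage_ae_eq_zero_left hf.enorm hg.enorm ?_ _ _)]
    · exact zero_le
    · filter_upwards [(eLpNorm_eq_zero_iff hf.aestronglyMeasurable
        (zero_lt_one.trans_le hp).ne').1 hf0] with x hx
      simp [hx]
  rcases eq_or_ne (eLpNorm g 1 volume) 0 with hg0 | hg0
  · rw [hvanish (bilinearAverage_ae_eq_zero_right hf.enorm hg.enorm ?_ _ _)]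
    · exact zero_le
    · filter_upwards [(eLpNorm_eq_zero_iff hg.aestronglyMeasurable one_ne_zero).1 hg0] with x hx
      simp [hx]
  have hC : ENNReal.ofReal ((1 + K) *
      ((2 : ℝ) ^ ((d : ℤ) * j) * (volume E).toReal) ^ (1 - (1 / p).toReal) *
      min ((2 : ℝ) ^ ((d : ℤ) * j)) (volume E).toReal ^ (1 / p).toReal) ≠ 0 := by
    rw [← pos_iff_ne_zero, ENNReal.ofReal_pos]
    have := lt_min hN he
    positivity
  rcases eq_or_ne (eLpNorm f p volume) ⊤ with hf1 | hf1
  · rw [hf1, ENNReal.mul_top hC, ENNReal.top_mul hg0]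
    exact le_top
  rcases eq_or_ne (eLpNorm g 1 volume) ⊤ with hg1 | hg1
  · rw [hg1, ENNReal.mul_top (mul_ne_zero hC hf0)]
    exact le_top
  have hb : 0 ≤ (1 / p).toReal := ENNReal.toReal_nonneg
  have hb1 : (1 / p).toReal ≤ 1 := by
    have h1 : 1 / p ≤ 1 := ENNReal.div_le_of_le_mul (by simpa using hp)
    simpa using ENNReal.toReal_mono ENNReal.one_ne_top h1
  have hvol := volume_closedBall_two_mul_zpow d j
  rw [← hKdef] at hvol
  have hw : ∀ x, ballIntegral (fun y => ‖f y‖ₑ) (2 * (2 : ℝ) ^ j) x ≠ ⊤ := fun x => by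
    refine ((ballIntegral_le hf hp _ x).trans_lt (ENNReal.mul_lt_top hf1.lt_top ?_)).ne
    rw [hvol]
    exact ENNReal.rpow_lt_top_of_nonneg (by linarith) ENNReal.ofReal_ne_top
  refine (eLpNorm_Ij_le hθ j E hf hg hg1 hw).trans ?_
  rw [mul_comm (eLpNorm g 1 volume), mul_comm (ENNReal.ofReal _)]
  refine mul_le_mul_left ?_ _
  have hEr : volume E = ENNReal.ofReal (volume E).toReal := (ENNReal.ofReal_toReal hEfin.ne).symm
  have hball := setLIntegral_ballIntegral_le_measure_mul hf hp (2 * (2 : ℝ) ^ j) E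
  have hset := setLIntegral_ballIntegral_le_measure_closedBall_mul hf hp (2 * (2 : ℝ) ^ j) E
  rw [hvol, hEr, ENNReal.ofReal_rpow_of_nonneg (by positivity) (by linarith),
    ← ENNReal.ofReal_mul (by positivity)] at hball hset
  have hmin := le_mul_rpow_mul_min_rpow hK hN he hb hb1
  rcases min_le_iff.1 hmin with h | h
  · exact hball.trans (by gcongr)
  · exact hset.trans (by gcongr)
end

section
/- Let d ∈ ℕ, 0 < α < d, θ ∈ [0,1), j ∈ ℤ, 1 ≤ p ≤ ∞, and let E ⊆ ℝ^d be measurable with |E| < ∞. Then there exists a constant C = C(α, d, p) > 0, independent of θ and j, such that for all nonnegative measurable functions f, g on ℝ^d, ‖I_j^θ(f,g) χ_E‖_{L^{1/2}(ℝ^d)} ≤ C · 2^{dj(1−1/p)} |E|^{2−α/d−1/p} ‖f‖_{L^p} ‖g‖_{L^{d/α}} · min{2^{dj}, |E|/(1−θ)^{d−α}}^{1/p}. -/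
open MeasureTheory Set
open scoped ENNReal NNReal

section BilinearAverage

variable {V : Type*} [NormedAddCommGroup V] [NormedSpace ℝ V] [MeasurableSpace V] [BorelSpace V]
  [FiniteDimensional ℝ V] {μ : Measure V}

/-- The bilinear average of `ℝ≥0∞`-valued functions over the closed ball of radius `R`. -/
noncomputable def lbilinAvg (μ : Measure V) (θ R : ℝ) (F G : V → ℝ≥0∞) (x : V) : ℝ≥0∞ :=
  ∫⁻ y in Metric.closedBall 0 R, F (x + (θ - 1) • y) * G (x + θ • y) ∂μ

theorem setLIntegral_rpow_le_of_le_one {X : Type*} [MeasurableSpace X] {ν : Measure X} {s : ℝ}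
    (hs0 : 0 ≤ s) (hs1 : s ≤ 1) (S : Set X) {h : X → ℝ≥0∞} (hh : Measurable h) :
    ∫⁻ x in S, h x ^ s ∂ν ≤ (∫⁻ x in S, h x ∂ν) ^ s * ν S ^ (1 - s) := by
  have := ENNReal.lintegral_mul_norm_pow_le (μ := ν.restrict S) (f := h) (g := fun _ => 1)
    hh.aemeasurable aemeasurable_const hs0 (sub_nonneg.2 hs1) (by ring)
  simpa using this

theorem setLIntegral_le_rpow_mul_measure {X : Type*} [MeasurableSpace X] {ν : Measure X} {s : ℝ}
    (hs0 : 0 < s) (hs1 : s ≤ 1) (S : Set X) {h : X → ℝ≥0∞} (hh : Measurable h) :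
    ∫⁻ x in S, h x ∂ν ≤ (∫⁻ x in S, h x ^ s⁻¹ ∂ν) ^ s * ν S ^ (1 - s) := by
  have := setLIntegral_rpow_le_of_le_one (ν := ν) hs0.le hs1 S (hh.pow_const s⁻¹)
  simpa [← ENNReal.rpow_mul, inv_mul_cancel₀ hs0.ne'] using this

theorem setLIntegral_sqrt_le {X : Type*} [MeasurableSpace X] {ν : Measure X}
    (S : Set X) {h : X → ℝ≥0∞} (hh : Measurable h) :
    ∫⁻ x in S, h x ^ (1 / 2 : ℝ) ∂ν ≤ (ν S * ∫⁻ x in S, h x ∂ν) ^ (1 / 2 : ℝ) := by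
  refine (setLIntegral_rpow_le_of_le_one (by norm_num) (by norm_num) S hh).trans_eq ?_
  rw [ENNReal.mul_rpow_of_nonneg _ _ (by norm_num), mul_comm]
  norm_num

variable [μ.IsAddHaarMeasure]

theorem measurable_lbilinAvg {θ R : ℝ} {F G : V → ℝ≥0∞} (hF : Measurable F) (hG : Measurable G) :
    Measurable (lbilinAvg μ θ R F G) := by
  unfold lbilinAvg
  exact Measurable.lintegral_prod_right'
    (f := fun p : V × V => F (p.1 + (θ - 1) • p.2) * G (p.1 + θ • p.2)) (by fun_prop)

theorem measurable_setLIntegral_closedBall (r : ℝ) {h : V → ℝ≥0∞} (hh : Measurable h) :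
    Measurable fun z => ∫⁻ x in Metric.closedBall z r, h x ∂μ := by
  have hm : MeasurableSet {p : V × V | dist p.2 p.1 ≤ r} :=
    measurableSet_le (by fun_prop) (by fun_prop)
  have h1 : (fun z => ∫⁻ x in Metric.closedBall z r, h x ∂μ)
      = fun z => ∫⁻ x, {p : V × V | dist p.2 p.1 ≤ r}.indicator (fun p => h p.2) (z, x) ∂μ := by
    funext z
    rw [← lintegral_indicator Metric.isClosed_closedBall.measurableSet]
    rfl
  rw [h1]
  exact Measurable.lintegral_prod_right' ((hh.comp measurable_snd).indicator hm)

theorem lintegral_setLIntegral_closedBall (r : ℝ) {h : V → ℝ≥0∞} (hh : Measurable h) :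
    ∫⁻ z, ∫⁻ x in Metric.closedBall z r, h x ∂μ ∂μ
      = μ (Metric.closedBall 0 r) * ∫⁻ x, h x ∂μ := by
  have hm : MeasurableSet {p : V × V | dist p.2 p.1 ≤ r} :=
    measurableSet_le (by fun_prop) (by fun_prop)
  have h1 : ∀ z, ∫⁻ x in Metric.closedBall z r, h x ∂μ
      = ∫⁻ x, {p : V × V | dist p.2 p.1 ≤ r}.indicator (fun p => h p.2) (z, x) ∂μ := by
    intro z
    rw [← lintegral_indicator Metric.isClosed_closedBall.measurableSet]
    rfl
  simp_rw [h1]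
  rw [lintegral_lintegral_swap
    (f := fun z x => {p : V × V | dist p.2 p.1 ≤ r}.indicator (fun p => h p.2) (z, x))
    ((hh.comp measurable_snd).indicator hm).aemeasurable, mul_comm, ← lintegral_mul_const _ hh]
  refine lintegral_congr fun x => ?_
  have h2 : ∀ z, {p : V × V | dist p.2 p.1 ≤ r}.indicator (fun p => h p.2) (z, x)
      = (Metric.closedBall x r).indicator (fun _ => h x) z := by
    intro z
    simp only [Set.indicator, Set.mem_ofPred_eq, Metric.mem_closedBall, dist_comm]
  simp_rw [h2]
  rw [lintegral_indicator_const Metric.isClosed_closedBall.measurableSet,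
    Measure.addHaar_closedBall_center]

theorem lintegral_bilinear_change_of_variables {θ : ℝ} {k F G : V → ℝ≥0∞} (hk : Measurable k)
    (hF : Measurable F) (hG : Measurable G) :
    ∫⁻ x, ∫⁻ y, k x * (F (x + (θ - 1) • y) * G (x + θ • y)) ∂μ ∂μ
      = ∫⁻ u, F u * ∫⁻ v, k (θ • u + (1 - θ) • v) * G v ∂μ ∂μ := by
  rw [lintegral_lintegral_swap
    (f := fun x y => k x * (F (x + (θ - 1) • y) * G (x + θ • y))) (by fun_prop)]
  have h1 : ∀ y, ∫⁻ x, k x * (F (x + (θ - 1) • y) * G (x + θ • y)) ∂μ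
      = ∫⁻ x, k (x + (1 - θ) • y) * (F x * G (x + y)) ∂μ := by
    intro y
    rw [← lintegral_add_right_eq_self _ ((1 - θ) • y)]
    refine lintegral_congr fun x => ?_
    have e1 : x + (1 - θ) • y + (θ - 1) • y = x := by module
    have e2 : x + (1 - θ) • y + θ • y = x + y := by module
    rw [e1, e2]
  simp_rw [h1]
  rw [lintegral_lintegral_swap
    (f := fun y x => k (x + (1 - θ) • y) * (F x * G (x + y))) (by fun_prop)]
  refine lintegral_congr fun u => ?_
  rw [← lintegral_const_mul _ (by fun_prop), ← lintegral_add_right_eq_self _ (-u)]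
  refine lintegral_congr fun v => ?_
  have e1 : u + (1 - θ) • (v + -u) = θ • u + (1 - θ) • v := by module
  have e2 : u + (v + -u) = v := by abel
  rw [e1, e2]
  ring

theorem measure_preimage_add_smul {r : ℝ} (hr : r ≠ 0) (u : V) (S : Set V) :
    μ ((fun v => u + r • v) ⁻¹' S) = ENNReal.ofReal |(r ^ Module.finrank ℝ V)⁻¹| * μ S := by
  have : (fun v : V => u + r • v) ⁻¹' S = (fun v => r • v) ⁻¹' ((fun h => u + h) ⁻¹' S) := rfl
  rw [this, Measure.addHaar_preimage_smul μ hr, measure_preimage_add]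

theorem setLIntegral_lbilinAvg_le {θ R s : ℝ} (hθ : θ < 1) (hs0 : 0 < s) (hs1 : s ≤ 1)
    {E : Set V} (hE : MeasurableSet E) {F G : V → ℝ≥0∞} (hF : Measurable F) (hG : Measurable G) :
    ∫⁻ x in E, lbilinAvg μ θ R F G x ∂μ ≤ (∫⁻ x, F x ∂μ) * ((∫⁻ x, G x ^ s⁻¹ ∂μ) ^ s *
      (ENNReal.ofReal (((1 - θ) ^ Module.finrank ℝ V)⁻¹) * μ E) ^ (1 - s)) := by
  calc ∫⁻ x in E, lbilinAvg μ θ R F G x ∂μ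
      ≤ ∫⁻ x, ∫⁻ y, E.indicator 1 x * (F (x + (θ - 1) • y) * G (x + θ • y)) ∂μ ∂μ := by
        rw [← lintegral_indicator hE]
        refine lintegral_mono fun x => ?_
        rw [lintegral_const_mul _ (by fun_prop)]
        by_cases hx : x ∈ E
        · simpa [hx, lbilinAvg] using setLIntegral_le_lintegral _ _
        · simp [hx]
    _ = ∫⁻ u, F u * ∫⁻ v, E.indicator 1 (θ • u + (1 - θ) • v) * G v ∂μ ∂μ :=
        lintegral_bilinear_change_of_variables (measurable_one.indicator hE) hF hG
    _ ≤ ∫⁻ u, F u * ((∫⁻ x, G x ^ s⁻¹ ∂μ) ^ s *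
      (ENNReal.ofReal (((1 - θ) ^ Module.finrank ℝ V)⁻¹) * μ E) ^ (1 - s)) ∂μ := by
        refine lintegral_mono fun u => ?_
        gcongr
        have hS : MeasurableSet ((fun v => θ • u + (1 - θ) • v) ⁻¹' E) :=
          hE.preimage (by fun_prop)
        have h0 : 0 ≤ ((1 - θ) ^ Module.finrank ℝ V)⁻¹ :=
          inv_nonneg.2 (pow_nonneg (sub_nonneg.2 hθ.le) _)
        rw [← abs_of_nonneg h0, ← measure_preimage_add_smul (sub_pos.2 hθ).ne' (θ • u) E]
        calc ∫⁻ v, E.indicator 1 (θ • u + (1 - θ) • v) * G v ∂μ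
            = ∫⁻ v in (fun v => θ • u + (1 - θ) • v) ⁻¹' E, G v ∂μ := by
              rw [← lintegral_indicator hS]
              refine lintegral_congr fun v => ?_
              by_cases hv : θ • u + (1 - θ) • v ∈ E <;> simp [Set.indicator, hv]
          _ ≤ _ := setLIntegral_le_rpow_mul_measure hs0 hs1 _ hG
          _ ≤ _ := by gcongr; exact Measure.restrict_le_self
    _ = _ := lintegral_mul_const _ hF

theorem setLIntegral_closedBall_lbilinAvg_le {θ R : ℝ} (hθ0 : 0 ≤ θ) (hθ1 : θ ≤ 1) (z : V)
    {F G : V → ℝ≥0∞} (hF : Measurable F) (hG : Measurable G) :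
    ∫⁻ x in Metric.closedBall z R, lbilinAvg μ θ R F G x ∂μ
      ≤ (∫⁻ x in Metric.closedBall z (2 * R), F x ∂μ)
        * ∫⁻ x in Metric.closedBall z (2 * R), G x ∂μ := by
  have hB : ∀ (z : V) (r : ℝ), MeasurableSet (Metric.closedBall z r) :=
    fun z r => Metric.isClosed_closedBall.measurableSet
  set F' := (Metric.closedBall z (2 * R)).indicator F with hF'
  set G' := (Metric.closedBall z (2 * R)).indicator G with hG'
  have hFm : Measurable F' := hF.indicator (hB _ _)
  have hGm : Measurable G' := hG.indicator (hB _ _)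
  have key : ∀ (x y : V) (c : ℝ), |c| ≤ 1 → x ∈ Metric.closedBall z R →
      y ∈ Metric.closedBall (0 : V) R → x + c • y ∈ Metric.closedBall z (2 * R) := by
    intro x y c hc hx hy
    rw [mem_closedBall_iff_norm] at hx hy ⊢
    rw [sub_zero] at hy
    have h1 : ‖c • y‖ ≤ R := by
      rw [norm_smul, Real.norm_eq_abs]
      nlinarith [norm_nonneg y]
    calc ‖x + c • y - z‖ = ‖(x - z) + c • y‖ := by congr 1; abel
      _ ≤ ‖x - z‖ + ‖c • y‖ := norm_add_le _ _
      _ ≤ 2 * R := by linarith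
  calc ∫⁻ x in Metric.closedBall z R, lbilinAvg μ θ R F G x ∂μ
      ≤ ∫⁻ x in Metric.closedBall z R, ∫⁻ y, 1 * (F' (x + (θ - 1) • y) * G' (x + θ • y)) ∂μ ∂μ := by
        refine setLIntegral_mono' (hB _ _) fun x hx => ?_
        refine le_trans (setLIntegral_mono' (hB _ _) fun y hy => ?_) (setLIntegral_le_lintegral _ _)
        rw [one_mul, hF', hG',
          Set.indicator_of_mem (key x y (θ - 1) (abs_le.2 ⟨by linarith, by linarith⟩) hx hy),
          Set.indicator_of_mem (key x y θ (abs_le.2 ⟨by linarith, by linarith⟩) hx hy)]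
    _ ≤ ∫⁻ x, ∫⁻ y, 1 * (F' (x + (θ - 1) • y) * G' (x + θ • y)) ∂μ ∂μ :=
        setLIntegral_le_lintegral _ _
    _ = ∫⁻ u, F' u * ∫⁻ v, 1 * G' v ∂μ ∂μ :=
        lintegral_bilinear_change_of_variables (k := fun _ => 1) measurable_const hFm hGm
    _ = _ := by
        simp_rw [one_mul]
        rw [lintegral_mul_const _ hFm, hF', hG', lintegral_indicator (hB _ _),
          lintegral_indicator (hB _ _)]

theorem lintegral_mul_rpow_three_le {X : Type*} [MeasurableSpace X] {ν : Measure X}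
    {a b c : X → ℝ≥0∞} (ha : Measurable a) (hb : Measurable b) (hc : Measurable c)
    {r s t : ℝ} (hr : 0 ≤ r) (hs : 0 ≤ s) (ht : 0 ≤ t) (h : r + s + t = 1) :
    ∫⁻ x, a x ^ r * b x ^ s * c x ^ t ∂ν
      ≤ (∫⁻ x, a x ∂ν) ^ r * (∫⁻ x, b x ∂ν) ^ s * (∫⁻ x, c x ∂ν) ^ t := by
  have := ENNReal.lintegral_prod_norm_pow_le (μ := ν) (Finset.univ : Finset (Fin 3))
    (f := ![a, b, c]) (p := ![r, s, t])
    (by intro i _; fin_cases i <;> simp [ha.aemeasurable, hb.aemeasurable, hc.aemeasurable])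
    (by simp [Fin.sum_univ_three, h])
    (by intro i _; fin_cases i <;> simp [hr, hs, ht])
  simpa [Fin.prod_univ_three] using this

theorem setLIntegral_sqrt_lbilinAvg_le_of_ball {θ R s : ℝ} (hθ0 : 0 ≤ θ) (hθ1 : θ ≤ 1) (hR : 0 < R)
    (hs0 : 0 < s) (hs1 : s ≤ 1) {E : Set V} (hE : MeasurableSet E) {F G : V → ℝ≥0∞}
    (hF : Measurable F) (hG : Measurable G) :
    ∫⁻ x in E, lbilinAvg μ θ R F G x ^ (1 / 2 : ℝ) ∂μ ≤
      (8 ^ Module.finrank ℝ V * μ (Metric.closedBall 0 R) *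
        (μ E ^ (1 - s) * (∫⁻ x, F x ∂μ) * (∫⁻ x, G x ^ s⁻¹ ∂μ) ^ s)) ^ (1 / 2 : ℝ) := by
  have hB : ∀ (z : V) (r : ℝ), MeasurableSet (Metric.closedBall z r) :=
    fun z r => Metric.isClosed_closedBall.measurableSet
  have hs1' : 0 ≤ 1 - s := sub_nonneg.2 hs1
  set b := μ (Metric.closedBall (0 : V) R) with hb
  set b₂ := μ (Metric.closedBall (0 : V) (2 * R)) with hb₂
  have hbb₂ : b₂ = 2 ^ Module.finrank ℝ V * b := by
    rw [hb, hb₂, Measure.addHaar_closedBall _ _ hR.le,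
      Measure.addHaar_closedBall _ _ (by positivity), mul_pow,
      ENNReal.ofReal_mul (by positivity), mul_assoc, ENNReal.ofReal_pow (by norm_num)]
    norm_num
  have hb0 : b ≠ 0 := (Metric.measure_closedBall_pos μ 0 hR).ne'
  have hbt : b ≠ ⊤ := measure_closedBall_lt_top.ne
  have hble : b ≤ b₂ := measure_mono (Metric.closedBall_subset_closedBall (by linarith))
  have hJ : Measurable (lbilinAvg μ θ R F G) := measurable_lbilinAvg hF hG
  have hE1 : Measurable (E.indicator (1 : V → ℝ≥0∞)) := measurable_one.indicator hE
  set m : V → ℝ≥0∞ := fun z => ∫⁻ x in Metric.closedBall z R, E.indicator 1 x ∂μ with hm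
  set Φ : V → ℝ≥0∞ := fun z => ∫⁻ x in Metric.closedBall z (2 * R), F x ∂μ with hΦ
  set Γ : V → ℝ≥0∞ := fun z => ∫⁻ x in Metric.closedBall z (2 * R), G x ^ s⁻¹ ∂μ with hΓ
  have hmm : Measurable m := measurable_setLIntegral_closedBall _ hE1
  have hΦm : Measurable Φ := measurable_setLIntegral_closedBall _ hF
  have hΓm : Measurable Γ := measurable_setLIntegral_closedBall _ (hG.pow_const _)
  have hlocal : ∀ z, ∫⁻ x in Metric.closedBall z R,
      E.indicator (fun x => lbilinAvg μ θ R F G x ^ (1 / 2 : ℝ)) x ∂μ ≤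
        b₂ ^ (1 / 2 : ℝ) * (m z ^ ((1 - s) / 2) * Φ z ^ (1 / 2 : ℝ) * Γ z ^ (s / 2)) := by
    intro z
    have hmz : m z = μ (E ∩ Metric.closedBall z R) := by
      rw [hm]
      simp only
      rw [lintegral_indicator_one hE, Measure.restrict_apply hE]
    have hmz' : m z ≤ m z ^ (1 - s) * b₂ ^ s := by
      calc m z = m z ^ (1 - s) * m z ^ s := by
            rw [← ENNReal.rpow_add_of_nonneg _ _ hs1' hs0.le]; simp
        _ ≤ _ := by
            gcongr
            rw [hmz]
            refine (measure_mono Set.inter_subset_right).trans ?_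
            rwa [Measure.addHaar_closedBall_center]
    have hint : ∫⁻ x in E ∩ Metric.closedBall z R, lbilinAvg μ θ R F G x ∂μ
        ≤ Φ z * (Γ z ^ s * b₂ ^ (1 - s)) := by
      refine (lintegral_mono_set Set.inter_subset_right).trans ?_
      refine (setLIntegral_closedBall_lbilinAvg_le hθ0 hθ1 z hF hG).trans ?_
      gcongr
      rw [hb₂, ← Measure.addHaar_closedBall_center μ z]
      exact setLIntegral_le_rpow_mul_measure hs0 hs1 _ hG
    rw [setLIntegral_indicator hE]
    refine (setLIntegral_sqrt_le _ hJ).trans ?_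
    rw [← hmz]
    calc (m z * ∫⁻ x in E ∩ Metric.closedBall z R, lbilinAvg μ θ R F G x ∂μ) ^ (1 / 2 : ℝ)
        ≤ ((m z ^ (1 - s) * b₂ ^ s) * (Φ z * (Γ z ^ s * b₂ ^ (1 - s)))) ^ (1 / 2 : ℝ) := by
          gcongr
      _ = ((b₂ ^ s * b₂ ^ (1 - s)) * (m z ^ (1 - s) * Φ z * Γ z ^ s)) ^ (1 / 2 : ℝ) := by
          congr 1; ring
      _ = _ := by
          rw [← ENNReal.rpow_add_of_nonneg _ _ hs0.le hs1', add_sub_cancel, ENNReal.rpow_one]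
          simp only [ENNReal.mul_rpow_of_nonneg _ _ (show (0 : ℝ) ≤ 1 / 2 by norm_num)]
          simp only [← ENNReal.rpow_mul, mul_one_div]
  have hglobal : b * ∫⁻ x in E, lbilinAvg μ θ R F G x ^ (1 / 2 : ℝ) ∂μ ≤
      b₂ ^ (1 / 2 : ℝ) * ((b * μ E) ^ ((1 - s) / 2) * (b₂ * ∫⁻ x, F x ∂μ) ^ (1 / 2 : ℝ) *
        (b₂ * ∫⁻ x, G x ^ s⁻¹ ∂μ) ^ (s / 2)) := by
    rw [← lintegral_indicator hE,
      ← lintegral_setLIntegral_closedBall R ((hJ.pow_const _).indicator hE)]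
    refine (lintegral_mono hlocal).trans ?_
    rw [lintegral_const_mul _ (by fun_prop)]
    gcongr
    refine (lintegral_mul_rpow_three_le hmm hΦm hΓm (by linarith) (by norm_num) (by linarith)
      (by ring)).trans_eq ?_
    rw [hm, hΦ, hΓ, lintegral_setLIntegral_closedBall _ hE1, lintegral_setLIntegral_closedBall _ hF,
      lintegral_setLIntegral_closedBall _ (hG.pow_const _), lintegral_indicator_one hE]
  refine (ENNReal.mul_le_mul_iff_right hb0 hbt).1 (hglobal.trans ?_)
  calc b₂ ^ (1 / 2 : ℝ) * ((b * μ E) ^ ((1 - s) / 2) * (b₂ * ∫⁻ x, F x ∂μ) ^ (1 / 2 : ℝ) *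
        (b₂ * ∫⁻ x, G x ^ s⁻¹ ∂μ) ^ (s / 2))
      ≤ b₂ ^ (1 / 2 : ℝ) * ((b₂ * μ E) ^ ((1 - s) / 2) * (b₂ * ∫⁻ x, F x ∂μ) ^ (1 / 2 : ℝ) *
        (b₂ * ∫⁻ x, G x ^ s⁻¹ ∂μ) ^ (s / 2)) := by
        gcongr
    _ = (b₂ * ((b₂ * μ E) ^ (1 - s) * (b₂ * ∫⁻ x, F x ∂μ) *
        (b₂ * ∫⁻ x, G x ^ s⁻¹ ∂μ) ^ s)) ^ (1 / 2 : ℝ) := by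
        simp only [ENNReal.mul_rpow_of_nonneg _ _ (show (0 : ℝ) ≤ 1 / 2 by norm_num),
          ← ENNReal.rpow_mul, mul_one_div]
    _ = ((b₂ * b₂ * (b₂ ^ (1 - s) * b₂ ^ s)) *
        (μ E ^ (1 - s) * (∫⁻ x, F x ∂μ) * (∫⁻ x, G x ^ s⁻¹ ∂μ) ^ s)) ^ (1 / 2 : ℝ) := by
        rw [ENNReal.mul_rpow_of_nonneg _ _ hs1', ENNReal.mul_rpow_of_nonneg _ _ hs0.le]
        congr 1; ring
    _ = ((b ^ (2 : ℝ)) * (8 ^ Module.finrank ℝ V * b *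
        (μ E ^ (1 - s) * (∫⁻ x, F x ∂μ) * (∫⁻ x, G x ^ s⁻¹ ∂μ) ^ s))) ^ (1 / 2 : ℝ) := by
        rw [← ENNReal.rpow_add_of_nonneg _ _ hs1' hs0.le, sub_add_cancel, ENNReal.rpow_one, hbb₂,
          show (8 : ℝ≥0∞) = 2 * 2 * 2 by norm_num, mul_pow, mul_pow, ENNReal.rpow_two]
        congr 1; ring
    _ = _ := by
        rw [ENNReal.mul_rpow_of_nonneg _ _ (by norm_num), ← ENNReal.rpow_mul]
        norm_num

theorem setLIntegral_sqrt_lbilinAvg_le {θ R s : ℝ} (hθ : θ < 1)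
    (hs0 : 0 < s) (hs1 : s ≤ 1) {E : Set V} (hE : MeasurableSet E) {F G : V → ℝ≥0∞}
    (hF : Measurable F) (hG : Measurable G) :
    ∫⁻ x in E, lbilinAvg μ θ R F G x ^ (1 / 2 : ℝ) ∂μ ≤
      (μ E * ENNReal.ofReal (((1 - θ) ^ Module.finrank ℝ V)⁻¹) ^ (1 - s) *
        (μ E ^ (1 - s) * (∫⁻ x, F x ∂μ) * (∫⁻ x, G x ^ s⁻¹ ∂μ) ^ s)) ^ (1 / 2 : ℝ) := by
  refine (setLIntegral_sqrt_le _ (measurable_lbilinAvg hF hG)).trans ?_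
  gcongr ?_ ^ _
  calc _ ≤ _ := mul_le_mul_right (setLIntegral_lbilinAvg_le hθ hs0 hs1 hE hF hG) _
    _ = _ := by
      rw [ENNReal.mul_rpow_of_nonneg _ _ (sub_nonneg.2 hs1)]
      ring

theorem setLIntegral_sqrt_lbilinAvg_one_le {θ R s : ℝ}
    (hs0 : 0 < s) (hs1 : s ≤ 1) (E : Set V) {G : V → ℝ≥0∞} (hG : Measurable G) :
    ∫⁻ x in E, lbilinAvg μ θ R 1 G x ^ (1 / 2 : ℝ) ∂μ ≤
      (μ (Metric.closedBall 0 R) * (μ E ^ (2 - s) * (∫⁻ x, G x ^ s⁻¹ ∂μ) ^ s)) ^ (1 / 2 : ℝ) := by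
  refine (setLIntegral_sqrt_le _ (measurable_lbilinAvg measurable_one hG)).trans ?_
  gcongr ?_ ^ _
  have h1 : ∀ y : V, ∫⁻ x in E, G (x + θ • y) ∂μ
      ≤ (∫⁻ x, G x ^ s⁻¹ ∂μ) ^ s * μ E ^ (1 - s) := by
    intro y
    refine (setLIntegral_le_rpow_mul_measure hs0 hs1 E (by fun_prop)).trans ?_
    gcongr ?_ ^ _ * _
    exact (setLIntegral_le_lintegral _ _).trans_eq
      (lintegral_add_right_eq_self (μ := μ) (fun x => G x ^ s⁻¹) _)
  calc μ E * ∫⁻ x in E, lbilinAvg μ θ R 1 G x ∂μ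
      = μ E * ∫⁻ y in Metric.closedBall 0 R, ∫⁻ x in E, G (x + θ • y) ∂μ ∂μ := by
        simp only [lbilinAvg, Pi.one_apply, one_mul]
        rw [lintegral_lintegral_swap (f := fun x y => G (x + θ • y)) (by fun_prop)]
    _ ≤ μ E * ∫⁻ y in Metric.closedBall 0 R, (∫⁻ x, G x ^ s⁻¹ ∂μ) ^ s * μ E ^ (1 - s) ∂μ := by
        gcongr with y
        exact h1 y
    _ = _ := by
        rw [setLIntegral_const, show 2 - s = 1 + (1 - s) by ring,
          ENNReal.rpow_add_of_nonneg _ _ zero_le_one (sub_nonneg.2 hs1), ENNReal.rpow_one]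
        ring

theorem setLIntegral_sqrt_lbilinAvg_le_interpolate {θ R t : ℝ} (ht0 : 0 < t) (ht1 : t ≤ 1)
    (E : Set V) {F G : V → ℝ≥0∞} (hF : Measurable F) (hG : Measurable G) :
    ∫⁻ x in E, lbilinAvg μ θ R F G x ^ (1 / 2 : ℝ) ∂μ ≤
      (∫⁻ x in E, lbilinAvg μ θ R (fun u => F u ^ t⁻¹) G x ^ (1 / 2 : ℝ) ∂μ) ^ t *
        (∫⁻ x in E, lbilinAvg μ θ R 1 G x ^ (1 / 2 : ℝ) ∂μ) ^ (1 - t) := by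
  have ht1' : 0 ≤ 1 - t := sub_nonneg.2 ht1
  have hFt : Measurable fun u => F u ^ t⁻¹ := hF.pow_const _
  have hpt : ∀ x, lbilinAvg μ θ R F G x ≤
      lbilinAvg μ θ R (fun u => F u ^ t⁻¹) G x ^ t * lbilinAvg μ θ R 1 G x ^ (1 - t) := by
    intro x
    refine le_trans (le_of_eq ?_) (ENNReal.lintegral_mul_norm_pow_le (p := t) (q := 1 - t)
      (by fun_prop) (by simp only [Pi.one_apply]; fun_prop) ht0.le ht1' (by ring))
    refine lintegral_congr fun y => ?_
    simp only [Pi.one_apply, one_mul]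
    rw [ENNReal.mul_rpow_of_nonneg _ _ ht0.le, ← ENNReal.rpow_mul, inv_mul_cancel₀ ht0.ne',
      ENNReal.rpow_one, mul_assoc, ← ENNReal.rpow_add_of_nonneg _ _ ht0.le ht1', add_sub_cancel,
      ENNReal.rpow_one]
  refine le_trans (lintegral_mono fun x => ?_) (ENNReal.lintegral_mul_norm_pow_le (p := t)
    (q := 1 - t) ((measurable_lbilinAvg hFt hG).pow_const _).aemeasurable
    ((measurable_lbilinAvg measurable_one hG).pow_const _).aemeasurable ht0.le ht1' (by ring))
  refine (ENNReal.rpow_le_rpow (hpt x) (by norm_num)).trans_eq ?_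
  rw [ENNReal.mul_rpow_of_nonneg _ _ (by norm_num)]
  simp only [← ENNReal.rpow_mul, mul_comm]

theorem lbilinAvg_le_of_ae_le {θ R : ℝ} (hθ : θ < 1) {c : ℝ≥0∞} {F G : V → ℝ≥0∞}
    (hG : Measurable G) (hFc : ∀ᵐ u ∂μ, F u ≤ c) (x : V) :
    lbilinAvg μ θ R F G x ≤ c * lbilinAvg μ θ R 1 G x := by
  have h : ∀ᵐ y ∂μ, F (x + (θ - 1) • y) ≤ c := by
    rw [ae_iff] at hFc ⊢
    have := measure_preimage_add_smul (μ := μ) (sub_neg.2 hθ).ne x {u | ¬ F u ≤ c}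
    rwa [hFc, mul_zero] at this
  unfold lbilinAvg
  rw [← lintegral_const_mul _ (by simp only [Pi.one_apply]; fun_prop)]
  refine lintegral_mono_ae ((ae_restrict_of_ae h).mono fun y hy => ?_)
  simp only [Pi.one_apply, one_mul]
  gcongr

end BilinearAverage
/-- `‖I_j^θ(f,g) χ_E‖_{L^{1/2}} ≤ C 2^{dj(1-1/p)} |E|^{2-α/d-1/p} ‖f‖_{L^p} ‖g‖_{L^{d/α}}
min{2^{dj}, |E|/(1-θ)^{d-α}}^{1/p}` for `1 ≤ p ≤ ∞` and `θ ∈ [0,1)`,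
with `C = C(α,d,p)` independent of `θ` and `j`. -/
theorem Ij_localized_bound_dalpha (d : ℕ) (hd : 0 < d) (α : ℝ) (hα : 0 < α) (hαd : α < d)
    (p : ℝ≥0∞) (hp : 1 ≤ p) :
    ∃ C : ℝ, 0 < C ∧ ∀ θ : ℝ, 0 ≤ θ → θ < 1 → ∀ j : ℤ,
      ∀ E : Set (EuclideanSpace ℝ (Fin d)), MeasurableSet E → volume E < ⊤ →
      ∀ f g : EuclideanSpace ℝ (Fin d) → ℝ, Measurable f → Measurable g →
        0 ≤ f → 0 ≤ g →
        eLpNorm (E.indicator (Ij d θ j f g)) (ENNReal.ofReal (1 / 2)) volume ≤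
          ENNReal.ofReal (C * (2 : ℝ) ^ (((d : ℝ) * j) * (1 - (1 / p).toReal)) *
              (volume E).toReal ^ (2 - α / d - (1 / p).toReal) *
              min ((2 : ℝ) ^ ((d : ℤ) * j)) ((volume E).toReal / (1 - θ) ^ ((d : ℝ) - α)) ^
                (1 / p).toReal) *
            eLpNorm f p volume * eLpNorm g (ENNReal.ofReal (d / α)) volume := by
  have hd' : (0 : ℝ) < d := by exact_mod_cast hd
  obtain ⟨s, hs⟩ : ∃ s, s = α / d := ⟨_, rfl⟩
  have hs0 : 0 < s := hs ▸ div_pos hα hd'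
  have hs1 : s < 1 := hs ▸ (div_lt_one hd').2 hαd
  have hsinv : (d : ℝ) / α = s⁻¹ := by rw [hs, inv_div]
  obtain ⟨ω, hω⟩ : ∃ ω, ω = volume (Metric.ball (0 : EuclideanSpace ℝ (Fin d)) 1) := ⟨_, rfl⟩
  have hωt : ω ≠ ⊤ := hω ▸ measure_ball_lt_top.ne
  refine ⟨8 ^ d * ω.toReal + 1, by positivity, ?_⟩
  intro θ hθ0 hθ1 j E hE hEt f g hf hg _ _
  obtain ⟨t, ht⟩ : ∃ t, t = (1 / p).toReal := ⟨_, rfl⟩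
  have ht0 : 0 ≤ t := ht ▸ ENNReal.toReal_nonneg
  have ht1 : t ≤ 1 := by
    rw [ht]
    exact ENNReal.toReal_le_of_le_ofReal zero_le_one (by simpa using hp)
  obtain ⟨K, hK⟩ : ∃ K, K = ENNReal.ofReal (8 ^ d * ω.toReal + 1) := ⟨_, rfl⟩
  obtain ⟨ρ, hρ⟩ : ∃ ρ, ρ = ENNReal.ofReal ((2 : ℝ) ^ ((d : ℤ) * j)) := ⟨_, rfl⟩
  obtain ⟨m, hm⟩ : ∃ m, m = ENNReal.ofReal (min ((2 : ℝ) ^ ((d : ℤ) * j))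
    ((volume E).toReal / (1 - θ) ^ ((d : ℝ) - α))) := ⟨_, rfl⟩
  have hKeq : K = 8 ^ d * ω + 1 := by
    rw [hK, ENNReal.ofReal_add (by positivity) zero_le_one, ENNReal.ofReal_mul (by positivity),
      ENNReal.ofReal_toReal hωt, ENNReal.ofReal_pow (by norm_num)]
    norm_num
  have h8K : 8 ^ d * ω ≤ K := hKeq ▸ le_self_add
  have hωK : ω ≤ K := le_trans (le_mul_of_one_le_left zero_le (one_le_pow₀ (by norm_num))) h8K
  have h1K : 1 ≤ K := hKeq ▸ le_add_self
  have hball : volume (Metric.closedBall (0 : EuclideanSpace ℝ (Fin d)) (2 ^ j)) = ρ * ω := by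
    rw [Measure.addHaar_closedBall _ _ (by positivity), ← hω, hρ, finrank_euclideanSpace_fin,
      mul_comm (d : ℤ) j, zpow_mul, zpow_natCast]
  set F : EuclideanSpace ℝ (Fin d) → ℝ≥0∞ := fun x => ‖f x‖ₑ with hF
  set G : EuclideanSpace ℝ (Fin d) → ℝ≥0∞ := fun x => ‖g x‖ₑ with hG
  have hFm : Measurable F := hf.enorm
  have hGm : Measurable G := hg.enorm
  have hGn : eLpNorm g (ENNReal.ofReal (d / α)) volume = (∫⁻ x, G x ^ s⁻¹) ^ s := by
    rw [hsinv, eLpNorm_eq_lintegral_rpow_enorm_toReal (by simpa using hs0) ENNReal.ofReal_ne_top,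
      ENNReal.toReal_ofReal (by positivity), one_div, inv_inv]
  set N := (∫⁻ x, G x ^ s⁻¹) ^ s
  set e := volume E
  have hLHS : eLpNorm (E.indicator (Ij d θ j f g)) (ENNReal.ofReal (1 / 2)) volume
      ≤ (∫⁻ x in E, lbilinAvg volume θ (2 ^ j) F G x ^ (1 / 2 : ℝ)) ^ (2 : ℝ) := by
    rw [eLpNorm_indicator_eq_eLpNorm_restrict hE,
      eLpNorm_eq_lintegral_rpow_enorm_toReal (by norm_num) ENNReal.ofReal_ne_top,
      ENNReal.toReal_ofReal (by norm_num), one_div_one_div]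
    gcongr with x
    refine (enorm_integral_le_lintegral_enorm _).trans_eq ?_
    have hset : {y : EuclideanSpace ℝ (Fin d) | ‖y‖ ≤ 2 ^ j} = Metric.closedBall 0 (2 ^ j) := by
      ext y; simp
    simp only [enorm_mul, hset, lbilinAvg, hF, hG]
  have hRHS : ENNReal.ofReal ((8 ^ d * ω.toReal + 1) *
      (2 : ℝ) ^ (((d : ℝ) * j) * (1 - t)) * e.toReal ^ (2 - s - t) *
      min ((2 : ℝ) ^ ((d : ℤ) * j)) (e.toReal / (1 - θ) ^ ((d : ℝ) - α)) ^ t)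
        = K * ρ ^ (1 - t) * e ^ (2 - s - t) * m ^ t := by
    rw [ENNReal.ofReal_mul (by positivity), ENNReal.ofReal_mul (by positivity),
      ENNReal.ofReal_mul (by positivity), hK, hρ, hm,
      ← ENNReal.ofReal_rpow_of_nonneg (by positivity) ht0,
      ← ENNReal.ofReal_rpow_of_nonneg ENNReal.toReal_nonneg (by linarith),
      ENNReal.ofReal_toReal hEt.ne, Real.rpow_mul (by norm_num),
      ENNReal.ofReal_rpow_of_nonneg (p := 1 - t) (by positivity) (by linarith),
      ← Real.rpow_intCast]
    push_cast
    rfl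
  have hone : ∫⁻ x in E, lbilinAvg volume θ (2 ^ j) 1 G x ^ (1 / 2 : ℝ)
      ≤ (K * ρ * (e ^ (2 - s) * N)) ^ (1 / 2 : ℝ) := by
    refine (setLIntegral_sqrt_lbilinAvg_one_le hs0 hs1.le E hGm).trans ?_
    rw [hball, mul_comm ρ ω]
    gcongr
  have hL1 : ∀ H : EuclideanSpace ℝ (Fin d) → ℝ≥0∞, Measurable H →
      ∫⁻ x in E, lbilinAvg volume θ (2 ^ j) H G x ^ (1 / 2 : ℝ)
        ≤ (K * m * (e ^ (1 - s) * (∫⁻ x, H x) * N)) ^ (1 / 2 : ℝ) := by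
    intro H hH
    rcases min_choice ((2 : ℝ) ^ ((d : ℤ) * j)) (e.toReal / (1 - θ) ^ ((d : ℝ) - α)) with h | h
    · rw [h, ← hρ] at hm
      refine (setLIntegral_sqrt_lbilinAvg_le_of_ball hθ0 hθ1.le (by positivity) hs0 hs1.le hE
        hH hGm).trans ?_
      rw [hball, finrank_euclideanSpace_fin, hm, mul_comm ρ ω, ← mul_assoc (8 ^ d)]
      gcongr
    · rw [h] at hm
      refine (setLIntegral_sqrt_lbilinAvg_le hθ1 hs0 hs1.le hE hH hGm).trans ?_
      have hme : e * ENNReal.ofReal (((1 - θ) ^ d)⁻¹) ^ (1 - s) = m := by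
        rw [hm, div_eq_mul_inv, ENNReal.ofReal_mul ENNReal.toReal_nonneg,
          ENNReal.ofReal_toReal hEt.ne, ENNReal.ofReal_rpow_of_nonneg
            (inv_nonneg.2 (pow_nonneg (sub_nonneg.2 hθ1.le) _)) (by linarith),
          Real.inv_rpow (pow_nonneg (sub_nonneg.2 hθ1.le) _), ← Real.rpow_natCast,
          ← Real.rpow_mul (sub_nonneg.2 hθ1.le)]
        congr 4
        rw [hs]
        field_simp
      rw [finrank_euclideanSpace_fin, hme]
      gcongr
      exact le_mul_of_one_le_left zero_le h1K
  rw [← ht, ← hs, hGn, hRHS]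
  refine hLHS.trans ?_
  by_cases hpt : p = ⊤
  · have ht00 : t = 0 := by simp [ht, hpt]
    have hle : ∀ x, lbilinAvg volume θ (2 ^ j) F G x ≤
        eLpNorm f p volume * lbilinAvg volume θ (2 ^ j) 1 G x := fun x =>
      lbilinAvg_le_of_ae_le hθ1 hGm (by rw [hpt, eLpNorm_exponent_top]; exact ae_le_eLpNormEssSup) x
    calc (∫⁻ x in E, lbilinAvg volume θ (2 ^ j) F G x ^ (1 / 2 : ℝ)) ^ (2 : ℝ)
        ≤ (∫⁻ x in E, eLpNorm f p volume ^ (1 / 2 : ℝ) *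
            lbilinAvg volume θ (2 ^ j) 1 G x ^ (1 / 2 : ℝ)) ^ (2 : ℝ) := by
          gcongr with x
          rw [← ENNReal.mul_rpow_of_nonneg _ _ (by norm_num)]
          gcongr
          exact hle x
      _ = (eLpNorm f p volume ^ (1 / 2 : ℝ) *
            ∫⁻ x in E, lbilinAvg volume θ (2 ^ j) 1 G x ^ (1 / 2 : ℝ)) ^ (2 : ℝ) := by
          rw [lintegral_const_mul _ ((measurable_lbilinAvg measurable_one hGm).pow_const _)]
      _ ≤ (eLpNorm f p volume ^ (1 / 2 : ℝ) *
            (K * ρ * (e ^ (2 - s) * N)) ^ (1 / 2 : ℝ)) ^ (2 : ℝ) := by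
          gcongr
      _ = eLpNorm f p volume * (K * ρ * (e ^ (2 - s) * N)) := by
          rw [← ENNReal.mul_rpow_of_nonneg _ _ (by norm_num), ← ENNReal.rpow_mul]
          norm_num
      _ = _ := by
          rw [ht00, sub_zero, sub_zero, ENNReal.rpow_zero, ENNReal.rpow_one]
          ring
  · have hp0 : p ≠ 0 := (zero_lt_one.trans_le hp).ne'
    have htP : t = 1 / p.toReal := by rw [ht, ENNReal.toReal_div, ENNReal.toReal_one]
    have ht0' : 0 < t := htP ▸ one_div_pos.2 (ENNReal.toReal_pos hp0 hpt)
    have ht1' : 0 ≤ 1 - t := sub_nonneg.2 ht1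
    have hFn : eLpNorm f p volume = (∫⁻ x, F x ^ t⁻¹) ^ t := by
      rw [eLpNorm_eq_lintegral_rpow_enorm_toReal hp0 hpt, htP, one_div, inv_inv]
    have hs1' : 0 ≤ 1 - s := sub_nonneg.2 hs1.le
    have hs2' : 0 ≤ 2 - s := by linarith
    have key : ∀ x : ℝ≥0∞, x ^ t * x ^ (1 - t) = x := fun x => by
      rw [← ENNReal.rpow_add_of_nonneg _ _ ht0 ht1', add_sub_cancel, ENNReal.rpow_one]
    have hee : (e ^ (1 - s)) ^ t * (e ^ (2 - s)) ^ (1 - t) = e ^ (2 - s - t) := by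
      rw [← ENNReal.rpow_mul, ← ENNReal.rpow_mul,
        ← ENNReal.rpow_add_of_nonneg _ _ (by positivity) (by positivity)]
      congr 1; ring
    calc (∫⁻ x in E, lbilinAvg volume θ (2 ^ j) F G x ^ (1 / 2 : ℝ)) ^ (2 : ℝ)
        ≤ (((K * m * (e ^ (1 - s) * (∫⁻ x, F x ^ t⁻¹) * N)) ^ (1 / 2 : ℝ)) ^ t *
            ((K * ρ * (e ^ (2 - s) * N)) ^ (1 / 2 : ℝ)) ^ (1 - t)) ^ (2 : ℝ) := by
          gcongr
          refine (setLIntegral_sqrt_lbilinAvg_le_interpolate ht0' ht1 E hFm hGm).trans ?_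
          gcongr
          exact hL1 _ (hFm.pow_const _)
      _ = (K * m * (e ^ (1 - s) * (∫⁻ x, F x ^ t⁻¹) * N)) ^ t *
            (K * ρ * (e ^ (2 - s) * N)) ^ (1 - t) := by
          rw [ENNReal.mul_rpow_of_nonneg _ _ (by norm_num)]
          simp only [← ENNReal.rpow_mul]
          congr 2 <;> ring
      _ = (K ^ t * K ^ (1 - t)) * ρ ^ (1 - t) * ((e ^ (1 - s)) ^ t * (e ^ (2 - s)) ^ (1 - t)) *
            m ^ t * (∫⁻ x, F x ^ t⁻¹) ^ t * (N ^ t * N ^ (1 - t)) := by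
          simp only [ENNReal.mul_rpow_of_nonneg _ _ ht0, ENNReal.mul_rpow_of_nonneg _ _ ht1']
          ring
      _ = _ := by rw [key, key, hee, hFn]
end
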